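/- arXiv:1811.01597 — 2 statements merged into one kernel-verified Lean document; each statement's English description precedes it below -/
import Mathlib

section
/- There exists a universal constant β ≥ 1 such that the following holds. Let G = (V,E) be a finite connected graph, let x ∈ [0,1]^E lie in the spanning tree polytope of G (the convex hull of the indicator vectors of the edge sets of spanning trees of G), and let b_v (v ∈ V) be integers with Σ_{e ∈ δ(v)} x_e ≤ b_v for every vertex v, where δ(v) is the set of edges incident to v. Then there exists a random spanning tree T of G such that: (i) with probability 1, the degree of every vertex v in T is at most b_v + 2; (ii) P[e ∈ T] = x_e for every edge e; and (iii) the indicator vector X ∈ {0,1}^E of T is β-concentrated around x. -/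
open MeasureTheory Finset

/-- A random `0`-`1` vector `X` with mean vector `x` is `β`-concentrated around `x` if
every linear functional `Σ_e a_e X_e` satisfies Bernstein's tail inequality up to a
factor `β` in the exponent, where `M = max_e |a_e|`. -/
def IsConcentrated {Ω ι : Type*} [Fintype ι] [MeasurableSpace Ω]
    (μ : Measure Ω) (X : Ω → ι → ℝ) (x : ι → ℝ) (β : ℝ) : Prop :=
  ∀ a : ι → ℝ, ∀ t : ℝ, 0 < t →
    (μ {ω | t ≤ ∑ i, a i * X ω i - ∑ i, a i * x i}).toReal ≤
      Real.exp (-(t ^ 2 / β) /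
        (2 * (∑ i, (a i) ^ 2 * (x i - (x i) ^ 2) + (⨆ i, |a i|) * t / 3)))

namespace DBST

lemma connected_of_edges {V : Type*} {G H : SimpleGraph V} (hG : G.Connected)
    (h : ∀ u v, G.Adj u v → H.Reachable u v) : H.Connected := by
  have := hG.nonempty
  refine SimpleGraph.Connected.mk ?_
  intro u v
  obtain ⟨p⟩ := hG.preconnected u v
  induction p with
  | nil => exact SimpleGraph.Reachable.refl _
  | cons hadj _ ih => exact (h _ _ hadj).trans ih

lemma reach_or {V : Type*} {G H : SimpleGraph V} (hG : G.Connected) (u v : V)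
    (h : ∀ x y, G.Adj x y → s(x, y) ≠ s(u, v) → H.Adj x y) (w : V) :
    H.Reachable w u ∨ H.Reachable w v := by
  obtain ⟨p⟩ := hG.preconnected w u
  have key : ∀ w z : V, G.Walk w z → z = u → H.Reachable w u ∨ H.Reachable w v := by
    intro w z p
    induction p with
    | nil => rintro rfl; left; exact SimpleGraph.Reachable.refl _
    | @cons x y z hadj _ ih =>
      intro hz
      by_cases he : s(x, y) = s(u, v)
      · rw [Sym2.eq_iff] at he
        rcases he with ⟨h1, h2⟩ | ⟨h1, h2⟩
        · left; rw [h1]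
        · right; rw [h1]
      · rcases ih hz with h1 | h1
        · left; exact (h _ _ hadj he).reachable.trans h1
        · right; exact (h _ _ hadj he).reachable.trans h1
  exact key w u p rfl

lemma tree_iff {V : Type*} [Fintype V] [DecidableEq V] (T : Finset (Sym2 V))
    (hT : ∀ e ∈ T, ¬ e.IsDiag) :
    (SimpleGraph.fromEdgeSet (↑T : Set (Sym2 V))).IsTree ↔
      (SimpleGraph.fromEdgeSet (↑T : Set (Sym2 V))).Connected ∧ T.card + 1 = Fintype.card V := by
  have : (SimpleGraph.fromEdgeSet (↑T : Set (Sym2 V))).edgeSet = ↑T := by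
    rw [SimpleGraph.edgeSet_fromEdgeSet]
    ext e
    simp only [Set.mem_sdiff, Finset.mem_coe]
    constructor
    · exact fun h => h.1
    · exact fun h => ⟨h, hT e h⟩
  rw [SimpleGraph.isTree_iff_connected_and_card, this]
  simp

lemma tree_exchange {V : Type*} [Fintype V] [DecidableEq V] (T₁ T₂ : Finset (Sym2 V))
    (hd₁ : ∀ e ∈ T₁, ¬ e.IsDiag) (hd₂ : ∀ e ∈ T₂, ¬ e.IsDiag)
    (h₁ : (SimpleGraph.fromEdgeSet (↑T₁ : Set (Sym2 V))).IsTree)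
    (h₂ : (SimpleGraph.fromEdgeSet (↑T₂ : Set (Sym2 V))).IsTree)
    (a : Sym2 V) (ha₁ : a ∈ T₁) (ha₂ : a ∉ T₂) :
    ∃ b ∈ T₂, b ∉ T₁ ∧
      (SimpleGraph.fromEdgeSet (↑(insert b (T₁.erase a)) : Set (Sym2 V))).IsTree ∧
      (SimpleGraph.fromEdgeSet (↑(insert a (T₂.erase b)) : Set (Sym2 V))).IsTree := by
  induction a with | _ u v => ?_
  have huv : u ≠ v := by simpa using hd₁ _ ha₁
  set G₁ := SimpleGraph.fromEdgeSet (↑T₁ : Set (Sym2 V)) with hG₁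
  set G₂ := SimpleGraph.fromEdgeSet (↑T₂ : Set (Sym2 V)) with hG₂
  have adj1 : ∀ x y, G₁.Adj x y ↔ s(x, y) ∈ T₁ ∧ x ≠ y := by
    intro x y; simp [hG₁]
  have adj2 : ∀ x y, G₂.Adj x y ↔ s(x, y) ∈ T₂ ∧ x ≠ y := by
    intro x y; simp [hG₂]
  set H₁ := SimpleGraph.fromEdgeSet (↑(T₁.erase s(u, v)) : Set (Sym2 V)) with hH₁
  have adjH1 : ∀ x y, H₁.Adj x y ↔ (s(x, y) ≠ s(u, v) ∧ s(x, y) ∈ T₁) ∧ x ≠ y := by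
    intro x y; rw [hH₁, SimpleGraph.fromEdgeSet_adj, Finset.mem_coe, Finset.mem_erase]
  have eqH1 : G₁.deleteEdges {s(u, v)} = H₁ := by
    ext x y
    rw [SimpleGraph.deleteEdges_adj, adj1, adjH1, Set.mem_singleton_iff]; tauto
  have hnr : ¬ H₁.Reachable u v := by
    have := SimpleGraph.isAcyclic_iff_forall_adj_isBridge.1 h₁.isAcyclic
      ((adj1 u v).2 ⟨ha₁, huv⟩)
    rw [SimpleGraph.isBridge_iff, eqH1] at this
    exact this
  obtain ⟨p, hp⟩ := (h₂.existsUnique_path u v).exists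
  obtain ⟨d, hd, hdS, hdS'⟩ := p.exists_boundary_dart {w | H₁.Reachable u w}
    (SimpleGraph.Reachable.refl _) hnr
  obtain ⟨⟨c, c'⟩, hcc⟩ := d
  simp only [Set.mem_ofPred_eq] at hdS hdS'
  have hcc2 := (adj2 _ _).1 hcc
  simp only at hcc2
  have hbT1 : s(c, c') ∉ T₁ := by
    intro hb
    refine hdS' (hdS.trans (SimpleGraph.Adj.reachable ?_))
    rw [adjH1]
    exact ⟨⟨fun h => ha₂ (h ▸ hcc2.1), hb⟩, hcc2.2⟩
  have hbp : s(c, c') ∈ p.edges := by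
    rw [SimpleGraph.Walk.edges, List.mem_map]
    exact ⟨_, hd, rfl⟩
  have hne : s(c, c') ≠ s(u, v) := fun h => ha₂ (h ▸ hcc2.1)
  refine ⟨s(c, c'), hcc2.1, hbT1, ?_, ?_⟩
  · rw [tree_iff]
    · constructor
      · set K := SimpleGraph.fromEdgeSet
          (↑(insert s(c, c') (T₁.erase s(u, v))) : Set (Sym2 V)) with hK
        have adjK : ∀ x y, K.Adj x y ↔
            (s(x, y) = s(c, c') ∨ (s(x, y) ≠ s(u, v) ∧ s(x, y) ∈ T₁)) ∧ x ≠ y := by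
          intro x y
          rw [hK, SimpleGraph.fromEdgeSet_adj, Finset.mem_coe, Finset.mem_insert,
            Finset.mem_erase]
        have hle : H₁ ≤ K := by
          intro x y h
          rw [adjH1] at h; rw [adjK]; tauto
        have hcv : H₁.Reachable c' v := by
          rcases reach_or (H := H₁) h₁.connected u v (by
            intro x y h1 h2; rw [adjH1]; rw [adj1] at h1; tauto) c' with h | h
          · exact absurd h.symm hdS'
          · exact h
        have hKuv : K.Reachable u v :=
          ((hdS.mono hle).trans (((adjK c c').2 ⟨Or.inl rfl, hcc2.2⟩).reachable)).trans
            (hcv.mono hle)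
        refine connected_of_edges h₁.connected ?_
        intro x y hxy
        by_cases he : s(x, y) = s(u, v)
        · rw [Sym2.eq_iff] at he
          rcases he with ⟨rfl, rfl⟩ | ⟨rfl, rfl⟩
          · exact hKuv
          · exact hKuv.symm
        · refine SimpleGraph.Adj.reachable ?_
          rw [adjK]; rw [adj1] at hxy; tauto
      · rw [Finset.card_insert_of_notMem (by simp [hbT1]), Finset.card_erase_add_one ha₁]
        exact ((tree_iff T₁ hd₁).1 h₁).2
    · intro e he
      rw [Finset.mem_insert] at he
      rcases he with rfl | he
      · simpa using hcc2.2
      · exact hd₁ e (Finset.mem_of_mem_erase he)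
  · rw [tree_iff]
    · constructor
      · set K := SimpleGraph.fromEdgeSet
          (↑(insert s(u, v) (T₂.erase s(c, c'))) : Set (Sym2 V)) with hK
        have adjK : ∀ x y, K.Adj x y ↔
            (s(x, y) = s(u, v) ∨ (s(x, y) ≠ s(c, c') ∧ s(x, y) ∈ T₂)) ∧ x ≠ y := by
          intro x y
          rw [hK, SimpleGraph.fromEdgeSet_adj, Finset.mem_coe, Finset.mem_insert,
            Finset.mem_erase]
        set H₂ := G₂.deleteEdges {s(c, c')} with hH₂
        have hle : H₂ ≤ K := by
          intro x y h
          rw [hH₂, SimpleGraph.deleteEdges_adj, adj2, Set.mem_singleton_iff] at h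
          rw [adjK]; tauto
        have hor : ∀ w, H₂.Reachable w c ∨ H₂.Reachable w c' := by
          refine reach_or h₂.connected c c' ?_
          intro x y h1 h2
          rw [hH₂, SimpleGraph.deleteEdges_adj, Set.mem_singleton_iff]
          exact ⟨h1, h2⟩
        have hnuv : ¬ H₂.Reachable u v := by
          intro hr
          obtain ⟨q, hq⟩ := hr.exists_isPath
          have hle2 : H₂ ≤ G₂ := SimpleGraph.deleteEdges_le _
          have hq2 := hq.mapLe hle2
          have heq := (h₂.existsUnique_path u v).unique hp hq2
          rw [heq, SimpleGraph.Walk.edges_mapLe_eq_edges] at hbp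
          have := q.edges_subset_edgeSet hbp
          rw [SimpleGraph.mem_edgeSet, hH₂, SimpleGraph.deleteEdges_adj] at this
          exact this.2 rfl
        have hKa : K.Reachable u v := ((adjK u v).2 ⟨Or.inl rfl, huv⟩).reachable
        have hKc : K.Reachable c c' := by
          rcases hor u with h1 | h1 <;> rcases hor v with h2 | h2
          · exact absurd (h1.trans h2.symm) hnuv
          · exact ((h1.symm.mono hle).trans hKa).trans (h2.mono hle)
          · exact (((h1.symm.mono hle).trans hKa).trans (h2.mono hle)).symm
          · exact absurd (h1.trans h2.symm) hnuv
        refine connected_of_edges h₂.connected ?_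
        intro x y hxy
        by_cases he : s(x, y) = s(c, c')
        · rw [Sym2.eq_iff] at he
          rcases he with ⟨rfl, rfl⟩ | ⟨rfl, rfl⟩
          · exact hKc
          · exact hKc.symm
        · refine SimpleGraph.Adj.reachable ?_
          rw [adjK]; rw [adj2] at hxy; tauto
      · rw [Finset.card_insert_of_notMem (by simp [ha₂]), Finset.card_erase_add_one hcc2.1]
        exact ((tree_iff T₂ hd₂).1 h₂).2
    · intro e he
      rw [Finset.mem_insert] at he
      rcases he with rfl | he
      · simpa using huv
      · exact hd₂ e (Finset.mem_of_mem_erase he)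
end DBST
namespace DBST

lemma minimax_finite {A τ : Type*} [Fintype A] [Fintype τ] (f : A → τ → ℝ) (u : A → ℝ)
    (h : ∀ w : A → ℝ, (∀ j, 0 ≤ w j) → ∃ T, ∑ j, w j * f j T ≤ ∑ j, w j * u j) :
    ∃ p ∈ stdSimplex ℝ τ, ∀ a, ∑ T, p T * f a T ≤ u a := by
  classical
  by_contra hcon
  push Not at hcon
  let v : τ → A → ℝ := fun T a => f a T
  let K : Set (A → ℝ) := (Fintype.linearCombination ℝ v) '' stdSimplex ℝ τ
  have hKc : Convex ℝ K := (convex_stdSimplex ℝ τ).linear_image _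
  have hKk : IsCompact K :=
    (isCompact_stdSimplex ℝ τ).image (LinearMap.continuous_of_finiteDimensional _)
  have hdisj : Disjoint (Set.Iic u) K := by
    rw [Set.disjoint_left]
    rintro y hy ⟨p, hp, rfl⟩
    obtain ⟨a, ha⟩ := hcon p hp
    have := hy a
    rw [Fintype.linearCombination_apply, Finset.sum_apply] at this
    simp only [Pi.smul_apply, smul_eq_mul, v] at this
    linarith
  obtain ⟨φ, s, t, h1, h2, h3⟩ := geometric_hahn_banach_closed_compact (convex_Iic u)
    isClosed_Iic hKc hKk hdisj
  have hφ : ∀ y : A → ℝ, φ y = ∑ j, φ (Pi.single j 1) * y j := by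
    intro y
    conv_lhs => rw [pi_eq_sum_univ' y]
    rw [map_sum]
    refine Finset.sum_congr rfl fun j _ => ?_
    rw [map_smul, smul_eq_mul, mul_comm]
  have hw : ∀ j, 0 ≤ φ (Pi.single j 1) := by
    intro j
    by_contra hneg
    push Not at hneg
    set c := φ (Pi.single j 1) with hc
    have hu := h1 u (Set.self_mem_Iic)
    set r : ℝ := (s - φ u) / (-c) with hr
    have hrpos : 0 < r := div_pos (by linarith) (by linarith)
    have := h1 (u - r • Pi.single j 1) (by
      rw [Set.mem_Iic, sub_le_self_iff]
      refine smul_nonneg hrpos.le ?_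
      intro i
      by_cases hij : i = j
      · subst hij; simp
      · simp [hij])
    rw [map_sub, map_smul, smul_eq_mul, ← hc] at this
    have h4 : r * (-c) = s - φ u := div_mul_cancel₀ _ (by linarith)
    linarith
  obtain ⟨T, hT⟩ := h (fun j => φ (Pi.single j 1)) hw
  have h4 := h1 u (Set.self_mem_Iic)
  have h5 := h3 (v T) ⟨Pi.single T 1, single_mem_stdSimplex ℝ T, by
    rw [Fintype.linearCombination_apply_single, one_smul]⟩
  rw [hφ u] at h4
  rw [hφ (v T)] at h5
  simp only [v] at h5
  linarith

lemma minimax {A τ : Type*} [Fintype τ] (f : A → τ → ℝ) (u : A → ℝ)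
    (h : ∀ (J : Finset A) (w : A → ℝ), (∀ j, 0 ≤ w j) →
      ∃ T, ∑ j ∈ J, w j * f j T ≤ ∑ j ∈ J, w j * u j) :
    ∃ p ∈ stdSimplex ℝ τ, ∀ a, ∑ T, p T * f a T ≤ u a := by
  classical
  have := (isCompact_stdSimplex ℝ τ).inter_iInter_nonempty
    (fun a : A => {p : τ → ℝ | ∑ T, p T * f a T ≤ u a})
    (fun a => isClosed_le (by fun_prop) continuous_const) (by
      intro J
      obtain ⟨p, hp, hp2⟩ := minimax_finite (fun (a : J) T => f a T) (fun a : J => u a) (by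
        intro w hw
        obtain ⟨T, hT⟩ := h J (fun a => if h : a ∈ J then w ⟨a, h⟩ else 0) (by
          intro j; split_ifs
          · exact hw _
          · exact le_rfl)
        refine ⟨T, ?_⟩
        rw [← Finset.sum_coe_sort J, ← Finset.sum_coe_sort J] at hT
        simpa using hT)
      refine ⟨p, hp, ?_⟩
      simp only [Set.mem_iInter]
      intro a ha
      exact hp2 ⟨a, ha⟩)
  obtain ⟨p, hp, hp2⟩ := this
  refine ⟨p, hp, fun a => ?_⟩
  exact Set.mem_iInter.1 hp2 a

lemma trace_dir {E J : Type*} [Fintype E] (s : Finset J) (F : Finset E)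
    (W : Submodule ℝ (E → ℝ)) (hW : ∀ d ∈ W, ∀ e, e ∉ F → d e = 0)
    (hdim : F.card ≤ 6 * Module.finrank ℝ W) (hF : F.Nonempty)
    (w : J → ℝ) (hw : ∀ j, 0 ≤ w j) (g : J → E → ℝ) (D : E → ℝ) (hD : ∀ e, 0 < D e)
    (hg : ∀ e ∈ F, ∑ j ∈ s, w j * g j e ^ 2 ≤ 4 / 18 * D e) :
    ∃ d ∈ W, ∑ j ∈ s, w j * (∑ e, g j e * d e) ^ 2 < 2 * ∑ e, D e * d e ^ 2 := by
  classical
  by_contra hcon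
  push Not at hcon
  let ψ : (E → ℝ) →ₗ[ℝ] EuclideanSpace ℝ E :=
    { toFun := fun d => WithLp.toLp 2 (fun e => √(D e) * d e)
      map_add' := by intro x y; ext e; simp [mul_add]
      map_smul' := by intro c x; ext e; simp; ring }
  have hψ : ∀ d e, ψ d e = √(D e) * d e := fun _ _ => rfl
  have hinj : Function.Injective ψ := by
    intro x y hxy
    ext e
    have := congrArg (fun z : EuclideanSpace ℝ E => z e) hxy
    simp only [hψ] at this
    exact mul_left_cancel₀ (Real.sqrt_ne_zero'.2 (hD e)) this
  let W' := W.map ψ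
  have hfr : Module.finrank ℝ W' = Module.finrank ℝ W :=
    (LinearEquiv.finrank_eq (Submodule.equivMapOfInjective ψ hinj W)).symm
  let b := stdOrthonormalBasis ℝ W'
  have hb : Orthonormal ℝ (fun i => (b i : EuclideanSpace ℝ E)) :=
    b.orthonormal.comp_linearIsometry W'.subtypeₗᵢ
  have hex : ∀ i, ∃ d ∈ W, ψ d = (b i : EuclideanSpace ℝ E) := fun i => (b i).2
  choose d hdW hd using hex
  let q : J → EuclideanSpace ℝ E :=
    fun j => WithLp.toLp 2 (fun e => if e ∈ F then g j e / √(D e) else 0)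
  have hin : ∀ i j, inner ℝ (b i : EuclideanSpace ℝ E) (q j) = ∑ e, g j e * d i e := by
    intro i j
    rw [← hd, PiLp.inner_apply]
    refine Finset.sum_congr rfl fun e _ => ?_
    rw [hψ]
    by_cases he : e ∈ F
    · have : √(D e) ≠ 0 := Real.sqrt_ne_zero'.2 (hD e)
      simp only [q, he, if_true, RCLike.inner_apply, conj_trivial]
      field_simp
    · simp [q, he, hW _ (hdW i) e he]
  have hnorm : ∀ i, ∑ e, D e * d i e ^ 2 = 1 := by
    intro i
    have h1 := hb.1 i
    have h2 : ‖(b i : EuclideanSpace ℝ E)‖ ^ 2 = 1 := by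
      simp only at h1
      rw [h1]; norm_num
    rw [← hd, EuclideanSpace.norm_sq_eq] at h2
    rw [← h2]
    refine Finset.sum_congr rfl fun e _ => ?_
    rw [hψ, Real.norm_eq_abs, sq_abs, mul_pow, Real.sq_sqrt (hD e).le]
  have hbes : ∀ j, ∑ i, (∑ e, g j e * d i e) ^ 2 ≤ ‖q j‖ ^ 2 := by
    intro j
    have := hb.sum_inner_products_le (x := q j) (s := Finset.univ)
    simpa [hin] using this
  have hq : ∀ j, ‖q j‖ ^ 2 = ∑ e ∈ F, g j e ^ 2 / D e := by
    intro j
    rw [EuclideanSpace.norm_sq_eq, ← Finset.sum_subset (Finset.subset_univ F)]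
    · refine Finset.sum_congr rfl fun e he => ?_
      simp only [q, he, if_true]
      rw [Real.norm_eq_abs, sq_abs, div_pow, Real.sq_sqrt (hD e).le]
    · intro e _ he
      simp [q, he]
  have hm : ∑ i : Fin (Module.finrank ℝ W'), (2 : ℝ) ≤ 4 / 18 * F.card := by
    calc ∑ i : Fin (Module.finrank ℝ W'), (2 : ℝ)
        ≤ ∑ i, ∑ j ∈ s, w j * (∑ e, g j e * d i e) ^ 2 := by
          refine Finset.sum_le_sum fun i _ => ?_
          have := hcon (d i) (hdW i)
          rwa [hnorm, mul_one] at this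
      _ = ∑ j ∈ s, w j * ∑ i, (∑ e, g j e * d i e) ^ 2 := by
          rw [Finset.sum_comm]
          simp_rw [Finset.mul_sum]
      _ ≤ ∑ j ∈ s, w j * ∑ e ∈ F, g j e ^ 2 / D e := by
          refine Finset.sum_le_sum fun j _ => mul_le_mul_of_nonneg_left ?_ (hw j)
          rw [← hq]; exact hbes j
      _ = ∑ e ∈ F, (∑ j ∈ s, w j * g j e ^ 2) / D e := by
          simp_rw [Finset.mul_sum, Finset.sum_div]
          rw [Finset.sum_comm]
          simp_rw [mul_div_assoc]
      _ ≤ ∑ e ∈ F, 4 / 18 := by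
          refine Finset.sum_le_sum fun e he => ?_
          rw [div_le_iff₀ (hD e)]
          exact hg e he
      _ = 4 / 18 * F.card := by rw [Finset.sum_const, nsmul_eq_mul, mul_comm]
  rw [Finset.sum_const, Finset.card_univ, Fintype.card_fin, hfr, nsmul_eq_mul] at hm
  have h1 : (F.card : ℝ) ≤ 6 * Module.finrank ℝ W := by exact_mod_cast hdim
  have h2 : (0 : ℝ) < F.card := by exact_mod_cast hF.card_pos
  linarith

lemma chernoff {E τ : Type*} [Fintype E] [DecidableEq E] [Fintype τ] (p : τ → ℝ) (hp : p ∈ stdSimplex ℝ τ)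
    (X : τ → E → ℝ) (x : E → ℝ) (hx : ∀ e, 0 ≤ x e ∧ x e ≤ 1)
    (hmgf : ∀ a : E → ℝ, (∀ e, |a e| ≤ 1 / 18) →
      ∑ T, p T * Real.exp (∑ e, a e * X T e) ≤
        Real.exp (∑ e, a e * x e + 18 * ∑ e, a e ^ 2 * (x e - x e ^ 2)))
    (a : E → ℝ) (t : ℝ) (ht : 0 < t) :
    ∑ T, (if t ≤ ∑ e, a e * X T e - ∑ e, a e * x e then p T else 0) ≤
      Real.exp (-(t ^ 2 / 54) /
        (2 * (∑ e, a e ^ 2 * (x e - x e ^ 2) + (⨆ e, |a e|) * t / 3))) := by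
  set S := ∑ e, a e ^ 2 * (x e - x e ^ 2) with hS
  set M := ⨆ e, |a e| with hM
  have hS0 : 0 ≤ S := Finset.sum_nonneg fun e _ =>
    mul_nonneg (sq_nonneg _) (by nlinarith [hx e])
  have hM0 : 0 ≤ M := Real.iSup_nonneg fun e => abs_nonneg _
  have hMa : ∀ e, |a e| ≤ M := fun e => le_ciSup (f := fun e => |a e|) (Set.finite_range _).bddAbove e
  have hMt : 0 ≤ M * t := mul_nonneg hM0 ht.le
  by_cases hD : 36 * S + 18 * (M * t) = 0
  · have h1 : S = 0 := by linarith
    have h2 : M * t = 0 := by linarith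
    rw [h1, h2]
    simp only [zero_div, add_zero, mul_zero, div_zero, Real.exp_zero]
    rw [← hp.2]
    refine Finset.sum_le_sum fun T _ => ?_
    split_ifs
    · exact le_rfl
    · exact hp.1 T
  · have hDpos : 0 < 36 * S + 18 * (M * t) := lt_of_le_of_ne (by linarith) (Ne.symm hD)
    set D := 36 * S + 18 * (M * t) with hDdef
    set l := t / D with hl
    have hlpos : 0 < l := div_pos ht hDpos
    have hlD : l * D = t := div_mul_cancel₀ _ hDpos.ne'
    have hlM : l * M ≤ 1 / 18 := by
      rw [hl, div_mul_eq_mul_div, div_le_iff₀ hDpos]; linarith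
    have hlS : 36 * S * l ≤ t := by nlinarith
    have hm := hmgf (fun e => l * a e) (fun e => by
      rw [abs_mul, abs_of_pos hlpos]
      exact (mul_le_mul_of_nonneg_left (hMa e) hlpos.le).trans hlM)
    have e1 : ∀ y : E → ℝ, ∑ e, l * a e * y e = l * ∑ e, a e * y e := by
      intro y; rw [Finset.mul_sum]; simp_rw [mul_assoc]
    have e2 : ∑ e, (l * a e) ^ 2 * (x e - x e ^ 2) = l ^ 2 * S := by
      rw [hS, Finset.mul_sum]; simp_rw [mul_pow, mul_assoc]
    rw [e1, e2] at hm
    simp_rw [e1] at hm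
    set B := ∑ e, a e * x e with hB
    calc ∑ T, (if t ≤ ∑ e, a e * X T e - B then p T else 0)
        ≤ ∑ T, (p T * Real.exp (l * ∑ e, a e * X T e)) * Real.exp (-(l * (B + t))) := by
          refine Finset.sum_le_sum fun T _ => ?_
          have hpT := hp.1 T
          split_ifs with hc
          · rw [mul_assoc, ← Real.exp_add]
            refine le_mul_of_one_le_right hpT (Real.one_le_exp ?_)
            nlinarith
          · positivity
      _ = (∑ T, p T * Real.exp (l * ∑ e, a e * X T e)) * Real.exp (-(l * (B + t))) := by
          rw [Finset.sum_mul]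
      _ ≤ Real.exp (l * B + 18 * (l ^ 2 * S)) * Real.exp (-(l * (B + t))) :=
          mul_le_mul_of_nonneg_right hm (Real.exp_pos _).le
      _ = Real.exp (18 * l ^ 2 * S - l * t) := by rw [← Real.exp_add]; congr 1; ring
      _ ≤ _ := by
          rw [Real.exp_le_exp]
          have h1 : 18 * l ^ 2 * S - l * t ≤ -(l * t / 2) := by nlinarith
          refine h1.trans ?_
          rw [neg_div, neg_le_neg_iff, div_div, hl, div_mul_eq_mul_div, div_div, ← sq]
          refine div_le_div_of_nonneg_left (sq_nonneg _) (by positivity) ?_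
          rw [hDdef]; linarith

lemma mean_eq {E τ : Type*} [Fintype E] [DecidableEq E] [Fintype τ] (p : τ → ℝ) (hp : p ∈ stdSimplex ℝ τ)
    (X : τ → E → ℝ) (hX : ∀ T e, 0 ≤ X T e ∧ X T e ≤ 1) (x : E → ℝ)
    (hx : ∀ e, 0 ≤ x e ∧ x e ≤ 1)
    (hmgf : ∀ a : E → ℝ, (∀ e, |a e| ≤ 1 / 18) →
      ∑ T, p T * Real.exp (∑ e, a e * X T e) ≤
        Real.exp (∑ e, a e * x e + 18 * ∑ e, a e ^ 2 * (x e - x e ^ 2))) (e : E) :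
    ∑ T, p T * X T e = x e := by
  set m := ∑ T, p T * X T e - x e with hm
  have h0 : 0 ≤ ∑ T, p T * X T e :=
    Finset.sum_nonneg fun T _ => mul_nonneg (hp.1 T) (hX T e).1
  have h1 : ∑ T, p T * X T e ≤ 1 := by
    rw [← hp.2]
    exact Finset.sum_le_sum fun T _ => mul_le_of_le_one_right (hp.1 T) (hX T e).2
  have hxe := hx e
  have hm1 : |m| ≤ 1 := by rw [abs_le]; constructor <;> linarith
  have hm2 : m ^ 2 ≤ 1 := by rw [← sq_abs]; nlinarith [abs_nonneg m]
  have h := hmgf (Pi.single e (m / 72)) (fun e' => by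
    by_cases h : e' = e
    · subst h
      rw [Pi.single_eq_same, abs_div]
      norm_num
      linarith
    · simp [h])
  have e1 : ∀ y : E → ℝ, ∑ e', (Pi.single e (m / 72) : E → ℝ) e' * y e' = m / 72 * y e := by
    intro y
    rw [Finset.sum_eq_single e]
    · simp
    · intro b _ hb; simp [hb]
    · simp
  have e2 : ∑ e', ((Pi.single e (m / 72) : E → ℝ) e') ^ 2 * (x e' - x e' ^ 2)
      = (m / 72) ^ 2 * (x e - x e ^ 2) := by
    rw [Finset.sum_eq_single e]
    · simp
    · intro b _ hb; simp [hb]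
    · simp
  rw [e1, e2] at h
  simp_rw [e1] at h
  set c := x e - x e ^ 2 with hc
  have hc0 : 0 ≤ c ∧ c ≤ 1 := by constructor <;> nlinarith
  have h2 : ∑ T, p T * (1 + (m / 72 * X T e - m / 72 * x e)) ≤
      Real.exp (18 * ((m / 72) ^ 2 * c)) := by
    calc _ ≤ ∑ T, (p T * Real.exp (m / 72 * X T e)) * Real.exp (-(m / 72 * x e)) := by
          refine Finset.sum_le_sum fun T _ => ?_
          rw [mul_assoc, ← Real.exp_add]
          refine mul_le_mul_of_nonneg_left ?_ (hp.1 T)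
          have := Real.add_one_le_exp (m / 72 * X T e + -(m / 72 * x e))
          linarith
      _ = (∑ T, p T * Real.exp (m / 72 * X T e)) * Real.exp (-(m / 72 * x e)) := by
          rw [Finset.sum_mul]
      _ ≤ _ := by
          refine (mul_le_mul_of_nonneg_right h (Real.exp_pos _).le).trans ?_
          rw [← Real.exp_add, Real.exp_le_exp]
          linarith
  have h3 : ∑ T, p T * (1 + (m / 72 * X T e - m / 72 * x e)) = 1 + m / 72 * m := by
    have : ∀ T, p T * (1 + (m / 72 * X T e - m / 72 * x e)) =
      p T * (1 - m / 72 * x e) + m / 72 * (p T * X T e) := fun T => by ring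
    simp_rw [this]
    rw [Finset.sum_add_distrib, ← Finset.sum_mul, ← Finset.mul_sum, hp.2, hm]
    ring
  rw [h3] at h2
  set z := 18 * ((m / 72) ^ 2 * c) with hz
  have hmc : m ^ 2 * c ≤ m ^ 2 := mul_le_of_le_one_right (sq_nonneg _) hc0.2
  have hz0 : 0 ≤ z := by have := hc0.1; positivity
  have hz1 : z ≤ m ^ 2 / 288 := by rw [hz]; nlinarith
  have h4 := Real.abs_exp_sub_one_le (x := z) (by rw [abs_of_nonneg hz0]; linarith)
  rw [abs_of_nonneg hz0] at h4
  have h5 := (abs_le.1 h4).2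
  have h6 : m ^ 2 ≤ 0 := by nlinarith
  have h7 : m = 0 := by nlinarith [sq_nonneg m, pow_eq_zero_iff (two_ne_zero) |>.1 (le_antisymm h6 (sq_nonneg m))]
  linarith
end DBST
namespace DBST

/-- indicator vector -/
def ind {E : Type*} [DecidableEq E] (T : Finset E) : E → ℝ := fun e => if e ∈ T then 1 else 0

/-- base polytope, by explicit convex combinations -/
def Poly {E : Type*} [Fintype E] [DecidableEq E] (B : Set (Finset E)) : Set (E → ℝ) :=
  {x | ∃ l : Finset E → ℝ, (∀ T, 0 ≤ l T) ∧ (∀ T, T ∉ B → l T = 0) ∧ ∑ T, l T = 1 ∧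
    x = ∑ T, l T • ind T}

lemma ind_nonneg {E : Type*} [DecidableEq E] (T : Finset E) (e : E) : 0 ≤ ind T e := by
  unfold ind; split_ifs <;> norm_num

lemma ind_le_one {E : Type*} [DecidableEq E] (T : Finset E) (e : E) : ind T e ≤ 1 := by
  unfold ind; split_ifs <;> norm_num

section
variable {E : Type*} [Fintype E] [DecidableEq E]

lemma poly_apply {l : Finset E → ℝ} (e : E) :
    (∑ T, l T • ind T) e = ∑ T, l T * ind T e := by
  rw [Finset.sum_apply]; rfl

lemma ind_mem_poly (B : Set (Finset E)) (T : Finset E) (hT : T ∈ B) : ind T ∈ Poly B := by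
  refine ⟨Pi.single T 1, ?_, ?_, ?_, ?_⟩
  · intro T'
    by_cases h : T' = T
    · subst h; simp
    · simp [h]
  · intro T' hT'
    have : T' ≠ T := fun h => hT' (h ▸ hT)
    simp [this]
  · simp
  · rw [Finset.sum_eq_single T]
    · simp
    · intro b _ hb; simp [hb]
    · simp

lemma poly_convex (B : Set (Finset E)) : Convex ℝ (Poly B) := by
  rintro x ⟨l, h1, h2, h3, rfl⟩ y ⟨m, k1, k2, k3, rfl⟩ a b ha hb hab
  refine ⟨fun T => a * l T + b * m T, ?_, ?_, ?_, ?_⟩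
  · intro T; have := h1 T; have := k1 T; positivity
  · intro T hT; simp [h2 T hT, k2 T hT]
  · rw [Finset.sum_add_distrib, ← Finset.mul_sum, ← Finset.mul_sum, h3, k3]; linarith
  · rw [Finset.smul_sum, Finset.smul_sum, ← Finset.sum_add_distrib]
    refine Finset.sum_congr rfl fun T _ => ?_
    rw [add_smul, smul_smul, smul_smul]

lemma poly_compact (B : Set (Finset E)) : IsCompact (Poly B) := by
  have h1 : IsCompact (stdSimplex ℝ (Finset E) ∩ {l | ∀ T, T ∉ B → l T = 0}) := by
    refine (isCompact_stdSimplex ℝ _).inter_right ?_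
    simp only [Set.ofPred_forall]
    refine isClosed_iInter fun T => isClosed_iInter fun _ => ?_
    exact isClosed_eq (continuous_apply T) continuous_const
  have h2 := h1.image (f := fun l : Finset E → ℝ => ∑ T, l T • ind T) (by fun_prop)
  convert h2 using 1
  ext x
  constructor
  · rintro ⟨l, h1, h2, h3, h4⟩
    exact ⟨l, ⟨⟨h1, h3⟩, h2⟩, h4.symm⟩
  · rintro ⟨l, ⟨⟨h1, h3⟩, h2⟩, h4⟩
    exact ⟨l, h1, h2, h3, h4.symm⟩

lemma poly_mem_Icc {B : Set (Finset E)} {x : E → ℝ} (hx : x ∈ Poly B) (e : E) :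
    0 ≤ x e ∧ x e ≤ 1 := by
  obtain ⟨l, h1, h2, h3, rfl⟩ := hx
  rw [poly_apply]
  constructor
  · exact Finset.sum_nonneg fun T _ => mul_nonneg (h1 T) (ind_nonneg T e)
  · rw [← h3]
    exact Finset.sum_le_sum fun T _ => mul_le_of_le_one_right (h1 T) (ind_le_one T e)

lemma convexHull_subset_poly (B : Set (Finset E)) (S : Set (E → ℝ))
    (hS : ∀ y ∈ S, ∃ T ∈ B, y = ind T) : convexHull ℝ S ⊆ Poly B := by
  refine convexHull_min ?_ (poly_convex B)
  intro y hy
  obtain ⟨T, hT, rfl⟩ := hS y hy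
  exact ind_mem_poly B T hT

/-- the space of two-sided feasible directions -/
def dirs {P : Set (E → ℝ)} (hP : Convex ℝ P) {x : E → ℝ} (hx : x ∈ P) :
    Submodule ℝ (E → ℝ) where
  carrier := {d | ∃ s : ℝ, 0 < s ∧ x + s • d ∈ P ∧ x - s • d ∈ P}
  zero_mem' := ⟨1, one_pos, by simpa using hx, by simpa using hx⟩
  add_mem' := by
    rintro d₁ d₂ ⟨s, hs, h1, h2⟩ ⟨t, ht, k1, k2⟩
    have hst : 0 < s + t := by linarith
    refine ⟨s * t / (s + t), by positivity, ?_, ?_⟩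
    · convert hP h1 k1 (a := t / (s + t)) (b := s / (s + t)) (by positivity) (by positivity)
        (by field_simp; ring) using 1
      ext e
      simp only [Pi.add_apply, Pi.smul_apply, smul_eq_mul]
      field_simp
      ring
    · convert hP h2 k2 (a := t / (s + t)) (b := s / (s + t)) (by positivity) (by positivity)
        (by field_simp; ring) using 1
      ext e
      simp only [Pi.add_apply, Pi.sub_apply, Pi.smul_apply, smul_eq_mul]
      field_simp
      ring
  smul_mem' := by
    rintro c d ⟨s, hs, h1, h2⟩
    rcases lt_trichotomy c 0 with hc | hc | hc
    · have e1 : (s / -c) • c • d = -(s • d) := by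
        rw [smul_smul, ← neg_smul]; congr 1
        have : c ≠ 0 := hc.ne
        field_simp
      refine ⟨s / (-c), div_pos hs (by linarith), ?_, ?_⟩
      · rw [e1, ← sub_eq_add_neg]; exact h2
      · rw [e1, sub_neg_eq_add]; exact h1
    · subst hc
      exact ⟨1, one_pos, by simpa using hx, by simpa using hx⟩
    · have e1 : (s / c) • c • d = s • d := by
        rw [smul_smul]; congr 1; field_simp
      exact ⟨s / c, div_pos hs hc, by rw [e1]; exact h1, by rw [e1]; exact h2⟩

lemma ind_exchange {E : Type*} [DecidableEq E] (T : Finset E) (a b : E) (ha : a ∈ T) (hb : b ∉ T) :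
    ind (insert b (T.erase a)) - ind T = Pi.single b 1 - Pi.single a 1 := by
  ext e
  have hab : a ≠ b := fun h => hb (h ▸ ha)
  simp only [Pi.sub_apply, ind, Finset.mem_insert, Finset.mem_erase, Pi.single_apply]
  by_cases h1 : e = a
  · subst h1; simp [ha, hab]
  · by_cases h2 : e = b
    · subst h2; simp [hb, h1]
    · simp [h1, h2]

lemma shift_mem {B : Set (Finset E)} {l : Finset E → ℝ} (h1 : ∀ T, 0 ≤ l T)
    (h2 : ∀ T, T ∉ B → l T = 0) (h3 : ∑ T, l T = 1) {T T' : Finset E} (hT : T ∈ B)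
    (hT' : T' ∈ B) {s : ℝ} (hs : 0 ≤ s) (hsl : s ≤ l T) :
    (∑ T, l T • ind T) + s • (ind T' - ind T) ∈ Poly B := by
  refine ⟨l + s • (Pi.single T' 1 - Pi.single T 1), ?_, ?_, ?_, ?_⟩
  · intro U
    have := h1 U
    have hs' : (0 : ℝ) ≤ (Pi.single T' 1 : Finset E → ℝ) U := by
      rw [Pi.single_apply]; split_ifs <;> norm_num
    have hs2 := mul_nonneg hs hs'
    simp only [Pi.add_apply, Pi.smul_apply, Pi.sub_apply, smul_eq_mul, mul_sub]
    by_cases hU : U = T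
    · subst hU; simp only [Pi.single_eq_same]; linarith
    · rw [Pi.single_eq_of_ne hU]; linarith
  · intro U hU
    have n1 : U ≠ T := fun h => hU (h ▸ hT)
    have n2 : U ≠ T' := fun h => hU (h ▸ hT')
    simp [h2 U hU, n1, n2]
  · simp [Finset.sum_add_distrib, ← Finset.mul_sum, h3]
  · have key : ∀ U : Finset E, ∑ V, (Pi.single U 1 : Finset E → ℝ) V • ind V = ind U := by
      intro U
      rw [Finset.sum_eq_single U]
      · simp
      · intro b _ hb; simp [hb]
      · simp
    simp only [Pi.add_apply, Pi.smul_apply, Pi.sub_apply, add_smul, smul_eq_mul, mul_smul,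
      sub_smul, Finset.sum_add_distrib, ← Finset.smul_sum, Finset.sum_sub_distrib, key]

/-- classes lemma -/
lemma classes {B : Set (Finset E)}
    (hex : ∀ T₁ ∈ B, ∀ T₂ ∈ B, ∀ a ∈ T₁, a ∉ T₂ → ∃ b ∈ T₂, b ∉ T₁ ∧
      insert b (T₁.erase a) ∈ B ∧ insert a (T₂.erase b) ∈ B)
    {x : E → ℝ} (hx : x ∈ Poly B) (F : Finset E) (hF : ∀ e, e ∈ F ↔ 0 < x e ∧ x e < 1) :
    ∃ (c : E → Finset E) (Q : Finset (Finset E)),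
      (∀ d : E → ℝ, (∀ e, e ∉ F → d e = 0) →
        (∀ C ∈ Q, ∑ e ∈ F with c e = C, d e = 0) → d ∈ dirs (poly_convex B) hx) ∧
      2 * Q.card ≤ F.card ∧ (Q.card : ℝ) ≤ ∑ e ∈ F, x e := by
  classical
  set L := dirs (poly_convex B) hx with hL
  obtain ⟨l, h1, h2, h3, hxl⟩ := id hx
  have hB : ∀ T, 0 < l T → T ∈ B := by
    intro T hT
    by_contra h
    rw [h2 T h] at hT
    exact lt_irrefl _ hT
  have hxe : ∀ e, x e = ∑ T, l T * ind T e := by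
    intro e; rw [← poly_apply, ← hxl]
  have hpos : ∀ T, 0 < l T → ∀ e ∈ T, 0 < x e := by
    intro T hT e he
    rw [hxe]
    refine Finset.sum_pos' (fun U _ => mul_nonneg (h1 U) (ind_nonneg U e))
      ⟨T, Finset.mem_univ _, ?_⟩
    simpa [ind, he] using hT
  have hlt : ∀ T, 0 < l T → ∀ e, e ∉ T → x e < 1 := by
    intro T hT e he
    rw [hxe, ← h3]
    refine Finset.sum_lt_sum (fun U _ => mul_le_of_le_one_right (h1 U) (ind_le_one U e))
      ⟨T, Finset.mem_univ _, ?_⟩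
    simpa [ind, he] using hT
  have hmemT : ∀ a, 0 < x a → ∃ T, 0 < l T ∧ a ∈ T := by
    intro a ha
    by_contra hcon
    push Not at hcon
    rw [hxe] at ha
    refine absurd ha (not_lt.2 (le_of_eq (Finset.sum_eq_zero fun T _ => ?_)))
    by_cases hT : 0 < l T
    · simp [ind, hcon T hT]
    · rw [le_antisymm (not_lt.1 hT) (h1 T), zero_mul]
  have hnmemT : ∀ a, x a < 1 → ∃ T, 0 < l T ∧ a ∉ T := by
    intro a ha
    by_contra hcon
    push Not at hcon
    rw [hxe, ← h3] at ha
    refine absurd ha (not_lt.2 (le_of_eq (Finset.sum_congr rfl fun T _ => ?_)))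
    by_cases hT : 0 < l T
    · simp [ind, hcon T hT]
    · rw [le_antisymm (not_lt.1 hT) (h1 T), zero_mul]
  -- key exchange
  have key : ∀ T₁ T₂, 0 < l T₁ → 0 < l T₂ → ∀ a ∈ T₁, a ∉ T₂ → ∃ b ∈ T₂, b ∉ T₁ ∧ b ∈ F ∧
      (Pi.single b 1 - Pi.single a 1 : E → ℝ) ∈ L := by
    intro T₁ T₂ ht1 ht2 a ha1 ha2
    obtain ⟨b, hb2, hb1, hm1, hm2⟩ := hex T₁ (hB _ ht1) T₂ (hB _ ht2) a ha1 ha2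
    refine ⟨b, hb2, hb1, (hF b).2 ⟨hpos _ ht2 _ hb2, hlt _ ht1 _ hb1⟩, ?_⟩
    refine ⟨min (l T₁) (l T₂), lt_min ht1 ht2, ?_, ?_⟩
    · have := shift_mem h1 h2 h3 (hB _ ht1) hm1 (lt_min ht1 ht2).le (min_le_left _ _)
      rwa [ind_exchange _ _ _ ha1 hb1, ← hxl] at this
    · have := shift_mem h1 h2 h3 (hB _ ht2) hm2 (lt_min ht1 ht2).le (min_le_right _ _)
      rw [ind_exchange _ _ _ hb2 ha2, ← hxl] at this
      rwa [sub_eq_add_neg, ← smul_neg, neg_sub]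
  let c : E → Finset E := fun e => {f ∈ F | (Pi.single f 1 - Pi.single e 1 : E → ℝ) ∈ L}
  have hc : ∀ e f, (Pi.single f 1 - Pi.single e 1 : E → ℝ) ∈ L → c f = c e := by
    intro e f hef
    ext g
    simp only [c, Finset.mem_filter]
    refine and_congr_right fun _ => ⟨fun h => ?_, fun h => ?_⟩
    · have := L.add_mem h hef
      rwa [sub_add_sub_cancel] at this
    · have := L.sub_mem h hef
      rwa [sub_sub_sub_cancel_right] at this
  have hc' : ∀ e ∈ F, ∀ f ∈ F, c f = c e → (Pi.single f 1 - Pi.single e 1 : E → ℝ) ∈ L := by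
    intro e he f hf h
    have : f ∈ c f := by
      simp only [c, Finset.mem_filter, sub_self]
      exact ⟨hf, L.zero_mem⟩
    rw [h] at this
    simp only [c, Finset.mem_filter] at this
    exact this.2
  have hmaps : ∀ e ∈ F, c e ∈ F.image c := fun e he => Finset.mem_image_of_mem _ he
  refine ⟨c, F.image c, ?_, ?_, ?_⟩
  · intro d hd hC
    have hdec : d = ∑ e ∈ F, d e • (Pi.single e 1 : E → ℝ) := by
      ext g
      rw [Finset.sum_apply]
      simp only [Pi.smul_apply, Pi.single_apply, smul_eq_mul, mul_ite, mul_one, mul_zero]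
      rw [Finset.sum_ite_eq]
      split_ifs with h
      · rfl
      · exact hd g h
    rw [hdec, ← Finset.sum_fiberwise_of_maps_to hmaps]
    refine L.sum_mem fun C hCQ => ?_
    obtain ⟨r, hr, rfl⟩ := Finset.mem_image.1 hCQ
    have e1 : ∑ e ∈ F with c e = c r, d e • (Pi.single e 1 : E → ℝ) =
        ∑ e ∈ F with c e = c r, d e • (Pi.single e 1 - Pi.single r 1 : E → ℝ) := by
      simp_rw [smul_sub]
      rw [Finset.sum_sub_distrib, ← Finset.sum_smul, hC _ hCQ, zero_smul, sub_zero]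
    rw [e1]
    refine L.sum_mem fun e he => L.smul_mem _ ?_
    rw [Finset.mem_filter] at he
    exact hc' r hr e he.1 he.2
  · rw [Finset.card_eq_sum_card_fiberwise hmaps, mul_comm, ← smul_eq_mul, ← Finset.sum_const]
    refine Finset.sum_le_sum fun C hCQ => ?_
    obtain ⟨a, ha, rfl⟩ := Finset.mem_image.1 hCQ
    obtain ⟨T₁, ht1, hm1⟩ := hmemT a ((hF a).1 ha).1
    obtain ⟨T₂, ht2, hm2⟩ := hnmemT a ((hF a).1 ha).2
    obtain ⟨b, hb2, hb1, hbF, hbL⟩ := key T₁ T₂ ht1 ht2 a hm1 hm2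
    have hne : a ≠ b := fun h => hb1 (h ▸ hm1)
    rw [← Finset.card_pair hne]
    refine Finset.card_le_card ?_
    intro g hg
    rw [Finset.mem_insert, Finset.mem_singleton] at hg
    rw [Finset.mem_filter]
    rcases hg with rfl | rfl
    · exact ⟨ha, rfl⟩
    · exact ⟨hbF, hc _ _ hbL⟩
  · rw [← Finset.sum_fiberwise_of_maps_to hmaps, Finset.card_eq_sum_ones, Nat.cast_sum]
    refine Finset.sum_le_sum fun C hCQ => ?_
    obtain ⟨a, ha, rfl⟩ := Finset.mem_image.1 hCQ
    simp_rw [hxe]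
    rw [Finset.sum_comm, Nat.cast_one, ← h3]
    refine Finset.sum_le_sum fun T _ => ?_
    rw [← Finset.mul_sum]
    by_cases hT : 0 < l T
    · refine le_mul_of_one_le_right (h1 T) ?_
      have : ∃ b ∈ T, b ∈ F ∧ c b = c a := by
        by_cases haT : a ∈ T
        · exact ⟨a, haT, ha, rfl⟩
        · obtain ⟨T₁, ht1, hm1⟩ := hmemT a ((hF a).1 ha).1
          obtain ⟨b, hb2, hb1, hbF, hbL⟩ := key T₁ T ht1 hT a hm1 haT
          exact ⟨b, hb2, hbF, hc _ _ hbL⟩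
      obtain ⟨b, hbT, hbF, hbc⟩ := this
      have h5 := Finset.single_le_sum (f := fun e => ind T e) (fun e _ => ind_nonneg T e)
        (Finset.mem_filter.2 ⟨hbF, hbc⟩ : b ∈ {e ∈ F | c e = c a})
      have h6 : ind T b = 1 := by simp [ind, hbT]
      simp only [h6] at h5
      exact h5
    · rw [le_antisymm (not_lt.1 hT) (h1 T), zero_mul]

lemma exists_subspace (F : Finset E) {I : Type*} [Fintype I] (f : I → (E → ℝ) →ₗ[ℝ] ℝ) :
    ∃ W : Submodule ℝ (E → ℝ), (∀ d ∈ W, ∀ e, e ∉ F → d e = 0) ∧ (∀ d ∈ W, ∀ i, f i d = 0) ∧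
      F.card ≤ Module.finrank ℝ W + Fintype.card I := by
  let ext : (F → ℝ) →ₗ[ℝ] (E → ℝ) :=
    { toFun := fun d e => if h : e ∈ F then d ⟨e, h⟩ else 0
      map_add' := by intro x y; ext e; by_cases h : e ∈ F <;> simp [h]
      map_smul' := by intro c x; ext e; by_cases h : e ∈ F <;> simp [h] }
  have hext : ∀ d e, ext d e = if h : e ∈ F then d ⟨e, h⟩ else 0 := fun _ _ => rfl
  have hinj : Function.Injective ext := by
    intro x y hxy
    funext e
    have := congrFun hxy e.1
    rw [hext, hext] at this
    simpa using this
  let Θ : (F → ℝ) →ₗ[ℝ] (I → ℝ) := (LinearMap.pi f).comp ext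
  refine ⟨(LinearMap.ker Θ).map ext, ?_, ?_, ?_⟩
  · rintro _ ⟨d, _, rfl⟩ e he
    rw [hext]; simp [he]
  · rintro _ ⟨d, hd, rfl⟩ i
    have := congrFun (LinearMap.mem_ker.1 hd) i
    simpa [Θ] using this
  · rw [← LinearEquiv.finrank_eq (Submodule.equivMapOfInjective ext hinj (LinearMap.ker Θ))]
    have h1 := LinearMap.finrank_range_add_finrank_ker Θ
    have h2 := Submodule.finrank_le (LinearMap.range Θ)
    rw [Module.finrank_fintype_fun_eq_card] at h1 h2
    rw [Fintype.card_coe] at h1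
    omega
end
end DBST
namespace DBST
section
variable {E V : Type*} [Fintype E] [DecidableEq E] [Fintype V] [DecidableEq V]

/-- the feasible region of the rounding procedure -/
def Reg (B : Set (Finset E)) (δ : V → Finset E) (b : V → ℤ) : Set (E → ℝ) :=
  {x | x ∈ Poly B ∧ ∀ v, ∑ e ∈ δ v, x e ≤ (b v : ℝ) ∨
    ∃ S : Finset E, (S.card : ℤ) ≤ b v + 2 ∧ ∀ e ∈ δ v, e ∉ S → x e = 0}

lemma reg_compact (B : Set (Finset E)) (δ : V → Finset E) (b : V → ℤ) :
    IsCompact (Reg B δ b) := by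
  have : Reg B δ b = Poly B ∩ ⋂ v, ({x | ∑ e ∈ δ v, x e ≤ (b v : ℝ)} ∪
      ⋃ S : Finset E, {x | (S.card : ℤ) ≤ b v + 2 ∧ ∀ e ∈ δ v, e ∉ S → x e = 0}) := by
    ext x
    simp [Reg]
  rw [this]
  refine (poly_compact B).inter_right (isClosed_iInter fun v => IsClosed.union ?_ ?_)
  · exact isClosed_le (by fun_prop) continuous_const
  · refine isClosed_iUnion_of_finite fun S => ?_
    by_cases h : (S.card : ℤ) ≤ b v + 2
    · simp only [h, true_and, Set.ofPred_forall]
      refine isClosed_iInter fun e => isClosed_iInter fun _ => isClosed_iInter fun _ => ?_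
      exact isClosed_eq (continuous_apply e) continuous_const
    · simp [h]

lemma good_dirs {B : Set (Finset E)}
    (hex : ∀ T₁ ∈ B, ∀ T₂ ∈ B, ∀ a ∈ T₁, a ∉ T₂ → ∃ b ∈ T₂, b ∉ T₁ ∧
      insert b (T₁.erase a) ∈ B ∧ insert a (T₂.erase b) ∈ B)
    {δ : V → Finset E} (hδ : ∀ e, #{v | e ∈ δ v} ≤ 2) {b : V → ℤ}
    {x : E → ℝ} (hx : x ∈ Reg B δ b) (F : Finset E) (hF : ∀ e, e ∈ F ↔ 0 < x e ∧ x e < 1) :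
    ∃ W : Submodule ℝ (E → ℝ), (∀ d ∈ W, ∀ e, e ∉ F → d e = 0) ∧
      F.card ≤ 6 * Module.finrank ℝ W ∧
      ∀ d ∈ W, ∃ s₀ : ℝ, 0 < s₀ ∧ ∀ s : ℝ, |s| ≤ s₀ → x + s • d ∈ Reg B δ b := by
  classical
  obtain ⟨hxP, hxR⟩ := hx
  have hI := fun e => poly_mem_Icc hxP e
  obtain ⟨c, Q, hQ1, hQ2, hQ3⟩ := classes hex hxP F hF
  let A : Finset V := {v | ¬ ∃ S : Finset E, (S.card : ℤ) ≤ b v + 2 ∧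
    ∀ e ∈ δ v, e ∉ S → x e = 0}
  have hA : ∀ v ∈ A, (3 : ℝ) ≤ ∑ e ∈ F, if e ∈ δ v then 1 - x e else 0 := by
    intro v hv
    simp only [A, Finset.mem_filter, Finset.mem_univ, true_and] at hv
    have hsum : ∑ e ∈ δ v, x e ≤ (b v : ℝ) := (hxR v).resolve_right hv
    have hcard : b v + 3 ≤ ((δ v).filter (fun e => x e ≠ 0)).card := by
      by_contra hlt
      refine hv ⟨(δ v).filter (fun e => x e ≠ 0), by omega, ?_⟩
      intro e he hne
      by_contra h0
      exact hne (Finset.mem_filter.2 ⟨he, h0⟩)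
    have hcard' : (b v : ℝ) + 3 ≤ ((δ v).filter (fun e => x e ≠ 0)).card := by
      exact_mod_cast hcard
    have e1 : ∑ e ∈ δ v, x e = ∑ e ∈ δ v with x e ≠ 0, x e := by
      rw [Finset.sum_filter_ne_zero]
    have e2 : ∑ e ∈ F, (if e ∈ δ v then 1 - x e else 0) =
        ∑ e ∈ δ v with x e ≠ 0, (1 - x e) := by
      rw [← Finset.sum_filter]
      refine Finset.sum_subset ?_ ?_
      · intro e he
        rw [Finset.mem_filter, hF] at he
        exact Finset.mem_filter.2 ⟨he.2, he.1.1.ne'⟩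
      · intro e he hne
        rw [Finset.mem_filter] at he
        have : ¬ (e ∈ F) := fun h => hne (Finset.mem_filter.2 ⟨h, he.1⟩)
        rw [hF] at this
        have hpos : 0 < x e := lt_of_le_of_ne (hI e).1 (Ne.symm he.2)
        have h1 : ¬ x e < 1 := fun h => this ⟨hpos, h⟩
        linarith [(hI e).2]
    rw [e2, Finset.sum_sub_distrib, ← e1, Finset.sum_const, nsmul_eq_mul, mul_one]
    linarith
  have hAcount : 3 * (A.card : ℝ) ≤ 2 * (F.card - ∑ e ∈ F, x e) := by
    calc 3 * (A.card : ℝ) = ∑ v ∈ A, (3 : ℝ) := by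
          rw [Finset.sum_const, nsmul_eq_mul, mul_comm]
      _ ≤ ∑ v ∈ A, ∑ e ∈ F, (if e ∈ δ v then 1 - x e else 0) := Finset.sum_le_sum hA
      _ ≤ ∑ v, ∑ e ∈ F, (if e ∈ δ v then 1 - x e else 0) := by
          refine Finset.sum_le_sum_of_subset_of_nonneg (Finset.subset_univ _) ?_
          intro v _ _
          refine Finset.sum_nonneg fun e _ => ?_
          split_ifs
          · linarith [(hI e).2]
          · exact le_rfl
      _ = ∑ e ∈ F, (#{v | e ∈ δ v} : ℝ) * (1 - x e) := by
          rw [Finset.sum_comm]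
          refine Finset.sum_congr rfl fun e _ => ?_
          rw [← Finset.sum_filter, Finset.sum_const, nsmul_eq_mul]
      _ ≤ ∑ e ∈ F, 2 * (1 - x e) := by
          refine Finset.sum_le_sum fun e _ => mul_le_mul_of_nonneg_right ?_ ?_
          · exact_mod_cast hδ e
          · linarith [(hI e).2]
      _ = _ := by
          rw [← Finset.mul_sum, Finset.sum_sub_distrib, Finset.sum_const, nsmul_eq_mul, mul_one]
  let f : (Q ⊕ A) → (E → ℝ) →ₗ[ℝ] ℝ := fun i => match i with
    | Sum.inl C => ∑ e ∈ F with c e = C.1, LinearMap.proj e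
    | Sum.inr v => ∑ e ∈ δ v.1, LinearMap.proj e
  obtain ⟨W, hW1, hW2, hW3⟩ := exists_subspace F f
  refine ⟨W, hW1, ?_, ?_⟩
  · rw [Fintype.card_sum, Fintype.card_coe, Fintype.card_coe] at hW3
    have h3 : (F.card : ℝ) ≤ Module.finrank ℝ W + (Q.card + A.card) := by exact_mod_cast hW3
    have h4 : 2 * (Q.card : ℝ) ≤ F.card := by exact_mod_cast hQ2
    have : (F.card : ℝ) ≤ 6 * Module.finrank ℝ W := by linarith
    exact_mod_cast this
  · intro d hd
    have hdF := hW1 d hd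
    have hdQ : ∀ C ∈ Q, ∑ e ∈ F with c e = C, d e = 0 := by
      intro C hC
      have := hW2 d hd (Sum.inl ⟨C, hC⟩)
      simpa [f, LinearMap.sum_apply] using this
    have hdA : ∀ v ∈ A, ∑ e ∈ δ v, d e = 0 := by
      intro v hv
      have := hW2 d hd (Sum.inr ⟨v, hv⟩)
      simpa [f, LinearMap.sum_apply] using this
    obtain ⟨s₀, hs₀, hp, hm⟩ := hQ1 d hdF hdQ
    refine ⟨s₀, hs₀, fun s hs => ⟨?_, ?_⟩⟩
    · rw [abs_le] at hs
      convert poly_convex B hp hm (a := (s₀ + s) / (2 * s₀)) (b := (s₀ - s) / (2 * s₀))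
        (div_nonneg (by linarith) (by linarith)) (div_nonneg (by linarith) (by linarith))
        (by field_simp; ring) using 1
      ext e
      simp only [Pi.add_apply, Pi.sub_apply, Pi.smul_apply, smul_eq_mul]
      field_simp
      ring
    · intro v
      by_cases hv : v ∈ A
      · left
        have h1 : ∑ e ∈ δ v, x e ≤ (b v : ℝ) := by
          refine (hxR v).resolve_right ?_
          simpa only [A, Finset.mem_filter, Finset.mem_univ, true_and] using hv
        simp only [Pi.add_apply, Pi.smul_apply, smul_eq_mul]
        rw [Finset.sum_add_distrib, ← Finset.mul_sum, hdA v hv]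
        linarith
      · right
        simp only [A, Finset.mem_filter, Finset.mem_univ, true_and, not_not] at hv
        obtain ⟨S, hS1, hS2⟩ := hv
        refine ⟨S, hS1, fun e he heS => ?_⟩
        have h0 := hS2 e he heS
        have : e ∉ F := by
          rw [hF]; rintro ⟨h, _⟩; linarith
        simp [h0, hdF e this]

lemma second_order {J : Type*} (s : Finset J) (w U : J → ℝ) (hw : ∀ j, 0 ≤ w j) (N s₀ : ℝ)
    (hs₀ : 0 < s₀)
    (h : ∀ r, 0 < r → r ≤ s₀ → 0 ≤ ∑ j ∈ s, w j * (Real.exp (r ^ 2 * U j) - 1) - r ^ 2 * N) :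
    0 ≤ ∑ j ∈ s, w j * U j - N := by
  by_contra hneg
  push Not at hneg
  set η := -(∑ j ∈ s, w j * U j - N) with hη
  have hηpos : 0 < η := by linarith
  set Z := ∑ j ∈ s, w j * U j ^ 2 with hZ
  have hZ0 : 0 ≤ Z := Finset.sum_nonneg fun j _ => mul_nonneg (hw j) (sq_nonneg _)
  set A := ∑ j ∈ s, |U j| + 1 with hA
  have hA0 : 0 < A := by
    have : 0 ≤ ∑ j ∈ s, |U j| := Finset.sum_nonneg fun j _ => abs_nonneg _
    linarith
  have hUA : ∀ j ∈ s, |U j| ≤ A := by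
    intro j hj
    have := Finset.single_le_sum (f := fun j => |U j|) (fun j _ => abs_nonneg _) hj
    linarith
  set q := min (s₀ ^ 2) (min (1 / A) (η / (2 * (Z + 1)))) with hq
  have hqpos : 0 < q := lt_min (by positivity) (lt_min (by positivity) (by positivity))
  have hq1 : q ≤ s₀ ^ 2 := min_le_left _ _
  have hq2 : q ≤ 1 / A := (min_le_right _ _).trans (min_le_left _ _)
  have hq3 : q ≤ η / (2 * (Z + 1)) := (min_le_right _ _).trans (min_le_right _ _)
  have h1 := h (√q) (Real.sqrt_pos.2 hqpos) (by
    rw [Real.sqrt_le_left hs₀.le]; exact hq1)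
  rw [Real.sq_sqrt hqpos.le] at h1
  have h2 : ∑ j ∈ s, w j * (Real.exp (q * U j) - 1) ≤
      ∑ j ∈ s, w j * (q * U j + q ^ 2 * U j ^ 2) := by
    refine Finset.sum_le_sum fun j hj => mul_le_mul_of_nonneg_left ?_ (hw j)
    have hb : |q * U j| ≤ 1 := by
      rw [abs_mul, abs_of_pos hqpos]
      calc q * |U j| ≤ 1 / A * A := by
            refine mul_le_mul hq2 (hUA j hj) (abs_nonneg _) (by positivity)
        _ = 1 := by field_simp
    have := (abs_le.1 (Real.abs_exp_sub_one_sub_id_le hb)).2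
    nlinarith
  have h3 : ∑ j ∈ s, w j * (q * U j + q ^ 2 * U j ^ 2) =
      q * ∑ j ∈ s, w j * U j + q ^ 2 * Z := by
    rw [hZ, Finset.mul_sum, Finset.mul_sum, ← Finset.sum_add_distrib]
    refine Finset.sum_congr rfl fun j _ => by ring
  have h4 : q * Z ≤ η / 2 := by
    have : q * (2 * (Z + 1)) ≤ η := by rwa [le_div_iff₀ (by positivity)] at hq3
    nlinarith
  have h5 : 0 ≤ q * (-η + q * Z) := by
    rw [hη]; nlinarith
  have h6 : -η + q * Z < 0 := by linarith
  nlinarith [mul_pos hqpos (neg_pos.2 h6)]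

/-- exponent of the potential -/
noncomputable def Ypot (a x : E → ℝ) : ℝ :=
  ∑ e, a e * x e + 18 * ∑ e, a e ^ 2 * (x e - x e ^ 2)

lemma Ypot_move (a x d : E → ℝ) (s : ℝ) :
    Ypot a (x + s • d) = Ypot a x + s * (∑ e, (a e + 18 * a e ^ 2 * (1 - 2 * x e)) * d e)
      - s ^ 2 * (18 * ∑ e, a e ^ 2 * d e ^ 2) := by
  unfold Ypot
  simp only [Finset.mul_sum, ← Finset.sum_add_distrib, ← Finset.sum_sub_distrib]
  refine Finset.sum_congr rfl fun e _ => ?_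
  simp only [Pi.add_apply, Pi.smul_apply, smul_eq_mul]
  ring

lemma round_eps {B : Set (Finset E)}
    (hex : ∀ T₁ ∈ B, ∀ T₂ ∈ B, ∀ a ∈ T₁, a ∉ T₂ → ∃ b ∈ T₂, b ∉ T₁ ∧
      insert b (T₁.erase a) ∈ B ∧ insert a (T₂.erase b) ∈ B)
    {δ : V → Finset E} (hδ : ∀ e, #{v | e ∈ δ v} ≤ 2) {b : V → ℤ}
    {x : E → ℝ} (hx : x ∈ Reg B δ b) (J : Finset (E → ℝ)) (w : (E → ℝ) → ℝ)
    (hw : ∀ a, 0 ≤ w a) (hJ : ∀ a ∈ J, ∀ e, |a e| ≤ 1 / 18) (ε : ℝ) (hε : 0 < ε) :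
    ∃ T ∈ B, ind T ∈ Reg B δ b ∧
      ∑ a ∈ J, w a * Real.exp (Ypot a (ind T)) ≤
        ∑ a ∈ J, w a * Real.exp (Ypot a x) + ε * ∑ e, (x e - x e ^ 2) := by
  classical
  let Ψ : (E → ℝ) → ℝ := fun y =>
    ∑ a ∈ J, w a * Real.exp (Ypot a y) + ε * ∑ e, (y e - y e ^ 2)
  have hcont : Continuous Ψ := by
    simp only [Ψ, Ypot]
    fun_prop
  obtain ⟨y, hyR, hymin⟩ := (reg_compact B δ b).exists_isMinOn ⟨x, hx⟩ hcont.continuousOn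
  have hmin : ∀ z ∈ Reg B δ b, Ψ y ≤ Ψ z := fun z hz => hymin hz
  have hI := fun e => poly_mem_Icc hyR.1 e
  let F : Finset E := {e | 0 < y e ∧ y e < 1}
  have hF : ∀ e, e ∈ F ↔ 0 < y e ∧ y e < 1 := by intro e; simp [F]
  by_cases hFe : F = ∅
  · -- integral
    have hint : ∀ e, y e = 0 ∨ y e = 1 := by
      intro e
      by_contra hcon
      push Not at hcon
      have : e ∈ F := (hF e).2 ⟨lt_of_le_of_ne (hI e).1 (Ne.symm hcon.1),
        lt_of_le_of_ne (hI e).2 hcon.2⟩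
      rw [hFe] at this
      exact absurd this (Finset.notMem_empty e)
    obtain ⟨l, h1, h2, h3, hyl⟩ := hyR.1
    have hye : ∀ e, y e = ∑ T, l T * ind T e := by
      intro e; rw [← poly_apply, ← hyl]
    obtain ⟨T, -, hT⟩ : ∃ T ∈ Finset.univ, 0 < l T := by
      by_contra hcon
      push Not at hcon
      have := Finset.sum_nonpos hcon
      linarith
    have hTB : T ∈ B := by
      by_contra h
      rw [h2 T h] at hT
      exact lt_irrefl _ hT
    have hyT : y = ind T := by
      ext e
      by_cases he : e ∈ T
      · have hpos : 0 < y e := by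
          rw [hye]
          refine Finset.sum_pos' (fun U _ => mul_nonneg (h1 U) (ind_nonneg U e))
            ⟨T, Finset.mem_univ _, ?_⟩
          simpa [ind, he] using hT
        rcases hint e with h | h
        · linarith
        · simp [ind, he, h]
      · have hlt : y e < 1 := by
          rw [hye, ← h3]
          refine Finset.sum_lt_sum
            (fun U _ => mul_le_of_le_one_right (h1 U) (ind_le_one U e))
            ⟨T, Finset.mem_univ _, ?_⟩
          simpa [ind, he] using hT
        rcases hint e with h | h
        · simp [ind, he, h]
        · linarith
    refine ⟨T, hTB, hyT ▸ hyR, ?_⟩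
    have h5 := hmin x hx
    rw [hyT] at h5
    have h6 : ∑ e, (ind T e - ind T e ^ 2) = 0 := by
      refine Finset.sum_eq_zero fun e _ => ?_
      by_cases he : e ∈ T <;> simp [ind, he]
    simp only [Ψ, h6, mul_zero, add_zero] at h5
    exact h5
  · exfalso
    obtain ⟨W, hW1, hW2, hW3⟩ := good_dirs hex hδ hyR F hF
    let wt : (E → ℝ) → ℝ := fun a => w a * Real.exp (Ypot a y)
    have hwt : ∀ a, 0 ≤ wt a := fun a => mul_nonneg (hw a) (Real.exp_pos _).le
    let g : (E → ℝ) → E → ℝ := fun a e => a e + 18 * a e ^ 2 * (1 - 2 * y e)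
    let D : E → ℝ := fun e => 18 * ∑ a ∈ J, wt a * a e ^ 2 + ε
    have hD : ∀ e, 0 < D e := by
      intro e
      have : 0 ≤ ∑ a ∈ J, wt a * a e ^ 2 :=
        Finset.sum_nonneg fun a _ => mul_nonneg (hwt a) (sq_nonneg _)
      simp only [D]; linarith
    have hg : ∀ e ∈ F, ∑ a ∈ J, wt a * g a e ^ 2 ≤ 4 / 18 * D e := by
      intro e he
      have h1 : ∑ a ∈ J, wt a * g a e ^ 2 ≤ ∑ a ∈ J, 4 * (wt a * a e ^ 2) := by
        refine Finset.sum_le_sum fun a ha => ?_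
        have h2 : g a e ^ 2 ≤ 4 * a e ^ 2 := by
          have hae := hJ a ha e
          have hu : |18 * a e * (1 - 2 * y e)| ≤ 1 := by
            rw [abs_mul, abs_mul]
            have h3 : |1 - 2 * y e| ≤ 1 := by
              rw [abs_le]; constructor <;> linarith [(hI e).1, (hI e).2]
            have h4 : |(18 : ℝ)| * |a e| ≤ 1 := by
              rw [abs_of_pos (by norm_num : (0 : ℝ) < 18)]; linarith
            calc _ ≤ (1 : ℝ) * 1 := mul_le_mul h4 h3 (abs_nonneg _) zero_le_one
              _ = 1 := one_mul 1
          have h5 : g a e = a e * (1 + 18 * a e * (1 - 2 * y e)) := by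
            simp only [g]; ring
          rw [h5, mul_pow, mul_comm 4]
          refine mul_le_mul_of_nonneg_left ?_ (sq_nonneg _)
          rw [abs_le] at hu
          nlinarith
        have := mul_le_mul_of_nonneg_left h2 (hwt a)
        linarith
      rw [← Finset.mul_sum] at h1
      simp only [D]
      linarith
    obtain ⟨d, hdW, hd⟩ := trace_dir J F W hW1 hW2 (Finset.nonempty_iff_ne_empty.2 hFe)
      wt hwt g D hD hg
    obtain ⟨s₀, hs₀, hmove⟩ := hW3 d hdW
    set G : (E → ℝ) → ℝ := fun a => ∑ e, g a e * d e with hG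
    set C : (E → ℝ) → ℝ := fun a => 18 * ∑ e, a e ^ 2 * d e ^ 2 with hC
    set N := ∑ e, d e ^ 2 with hN
    have hso := second_order J wt (fun a => G a ^ 2 / 2 - C a) hwt (ε * N) s₀ hs₀ (by
      intro r hr hrs
      have k1 := hmin _ (hmove r (by rwa [abs_of_pos hr]))
      have k2 := hmin _ (hmove (-r) (by rwa [abs_neg, abs_of_pos hr]))
      simp only [Ψ] at k1 k2
      have e1 : ∑ e, ((y + r • d) e - (y + r • d) e ^ 2) +
          ∑ e, ((y + (-r) • d) e - (y + (-r) • d) e ^ 2) =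
          2 * ∑ e, (y e - y e ^ 2) - 2 * r ^ 2 * N := by
        rw [hN]
        simp only [Finset.mul_sum, ← Finset.sum_add_distrib, ← Finset.sum_sub_distrib]
        refine Finset.sum_congr rfl fun e _ => ?_
        simp only [Pi.add_apply, Pi.smul_apply, smul_eq_mul]
        ring
      have e2 : ∑ a ∈ J, w a * Real.exp (Ypot a (y + r • d)) +
          ∑ a ∈ J, w a * Real.exp (Ypot a (y + (-r) • d)) ≤
          2 * ∑ a ∈ J, wt a * Real.exp (r ^ 2 * (G a ^ 2 / 2 - C a)) := by
        rw [← Finset.sum_add_distrib, Finset.mul_sum]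
        refine Finset.sum_le_sum fun a _ => ?_
        rw [Ypot_move, Ypot_move]
        have e3 : Real.exp (Ypot a y + r * G a - r ^ 2 * C a) +
            Real.exp (Ypot a y + -r * G a - (-r) ^ 2 * C a) =
            2 * (Real.exp (Ypot a y) * (Real.exp (-(r ^ 2 * C a)) * Real.cosh (r * G a))) := by
          rw [Real.cosh_eq]
          have : ∀ z : ℝ, Ypot a y + z - r ^ 2 * C a = Ypot a y + (-(r ^ 2 * C a) + z) :=
            fun z => by ring
          rw [neg_sq, this, this, Real.exp_add, Real.exp_add, Real.exp_add, Real.exp_add,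
            neg_mul]
          ring
        have e4 := Real.cosh_le_exp_half_sq (r * G a)
        have e5 : Real.exp (-(r ^ 2 * C a)) * Real.cosh (r * G a) ≤
            Real.exp (r ^ 2 * (G a ^ 2 / 2 - C a)) := by
          refine (mul_le_mul_of_nonneg_left e4 (Real.exp_pos _).le).trans (le_of_eq ?_)
          rw [← Real.exp_add]; congr 1; ring
        have e6 := mul_le_mul_of_nonneg_left e5 (hwt a)
        have e7 : w a * Real.exp (Ypot a y + r * G a - r ^ 2 * C a) +
            w a * Real.exp (Ypot a y + -r * G a - (-r) ^ 2 * C a) =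
            2 * (wt a * (Real.exp (-(r ^ 2 * C a)) * Real.cosh (r * G a))) := by
          rw [← mul_add, e3]; simp only [wt]; ring
        calc _ = _ := e7
          _ ≤ _ := by linarith
      have e8 : ∑ a ∈ J, wt a * (Real.exp (r ^ 2 * (G a ^ 2 / 2 - C a)) - 1) =
          ∑ a ∈ J, wt a * Real.exp (r ^ 2 * (G a ^ 2 / 2 - C a)) -
            ∑ a ∈ J, w a * Real.exp (Ypot a y) := by
        rw [← Finset.sum_sub_distrib]
        refine Finset.sum_congr rfl fun a _ => by simp only [wt]; ring
      rw [e8]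
      have e9 := congrArg (fun z => ε * z) e1
      simp only [mul_add, mul_sub] at e9
      nlinarith)
    have f1 : ∑ a ∈ J, wt a * (G a ^ 2 / 2 - C a) =
        (∑ a ∈ J, wt a * G a ^ 2) / 2 - ∑ a ∈ J, wt a * C a := by
      rw [Finset.sum_div, ← Finset.sum_sub_distrib]
      refine Finset.sum_congr rfl fun a _ => by ring
    have f2 : ∑ e, D e * d e ^ 2 = ∑ a ∈ J, wt a * C a + ε * N := by
      simp only [D, add_mul, Finset.sum_add_distrib, hN, hC]
      rw [Finset.mul_sum univ _ ε]
      congr 1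
      simp only [Finset.mul_sum, Finset.sum_mul]
      rw [Finset.sum_comm]
      refine Finset.sum_congr rfl fun a _ => Finset.sum_congr rfl fun e _ => by ring
    rw [f2] at hd
    rw [f1] at hso
    linarith

lemma round_exact {B : Set (Finset E)}
    (hex : ∀ T₁ ∈ B, ∀ T₂ ∈ B, ∀ a ∈ T₁, a ∉ T₂ → ∃ b ∈ T₂, b ∉ T₁ ∧
      insert b (T₁.erase a) ∈ B ∧ insert a (T₂.erase b) ∈ B)
    {δ : V → Finset E} (hδ : ∀ e, #{v | e ∈ δ v} ≤ 2) {b : V → ℤ}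
    {x : E → ℝ} (hx : x ∈ Reg B δ b) (J : Finset (E → ℝ)) (w : (E → ℝ) → ℝ)
    (hw : ∀ a, 0 ≤ w a) (hJ : ∀ a ∈ J, ∀ e, |a e| ≤ 1 / 18) :
    ∃ T ∈ B, ind T ∈ Reg B δ b ∧
      ∑ a ∈ J, w a * Real.exp (Ypot a (ind T)) ≤ ∑ a ∈ J, w a * Real.exp (Ypot a x) := by
  classical
  have hr := round_eps hex hδ hx J w hw hJ
  let Gd : Finset (Finset E) := {T | T ∈ B ∧ ind T ∈ Reg B δ b}
  have hne : Gd.Nonempty := by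
    obtain ⟨T, h1, h2, _⟩ := hr 1 one_pos
    exact ⟨T, by simp [Gd, h1, h2]⟩
  obtain ⟨T, hT, hmin⟩ := Finset.exists_min_image Gd
    (fun T => ∑ a ∈ J, w a * Real.exp (Ypot a (ind T))) hne
  have hT' : T ∈ B ∧ ind T ∈ Reg B δ b := by simpa [Gd] using hT
  refine ⟨T, hT'.1, hT'.2, ?_⟩
  set K := ∑ e, (x e - x e ^ 2) with hK
  have hK0 : 0 ≤ K := Finset.sum_nonneg fun e _ => by
    have := poly_mem_Icc hx.1 e
    nlinarith
  refine le_of_forall_pos_le_add fun ε hε => ?_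
  obtain ⟨T', h1, h2, h3⟩ := hr (ε / (K + 1)) (by positivity)
  have h4 := hmin T' (by simp [Gd, h1, h2])
  have h5 : ε / (K + 1) * K ≤ ε := by
    rw [div_mul_eq_mul_div, div_le_iff₀ (by linarith)]
    nlinarith
  linarith

lemma exists_distribution {B : Set (Finset E)}
    (hex : ∀ T₁ ∈ B, ∀ T₂ ∈ B, ∀ a ∈ T₁, a ∉ T₂ → ∃ b ∈ T₂, b ∉ T₁ ∧
      insert b (T₁.erase a) ∈ B ∧ insert a (T₂.erase b) ∈ B)
    {δ : V → Finset E} (hδ : ∀ e, #{v | e ∈ δ v} ≤ 2) {b : V → ℤ}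
    {x : E → ℝ} (hx : x ∈ Poly B) (hb : ∀ v, ∑ e ∈ δ v, x e ≤ (b v : ℝ)) :
    ∃ p ∈ stdSimplex ℝ (Finset E),
      (∀ T, p T ≠ 0 → T ∈ B ∧ ∀ v, ((T ∩ δ v).card : ℝ) ≤ (b v : ℝ) + 2) ∧
      ∀ a : E → ℝ, (∀ e, |a e| ≤ 1 / 18) →
        ∑ T, p T * Real.exp (∑ e, a e * ind T e) ≤
        Real.exp (∑ e, a e * x e + 18 * ∑ e, a e ^ 2 * (x e - x e ^ 2)) := by
  classical
  have hxR : x ∈ Reg B δ b := ⟨hx, fun v => Or.inl (hb v)⟩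
  let τ := {T : Finset E // T ∈ B ∧ ind T ∈ Reg B δ b}
  have hY : ∀ (a : E → ℝ) (T : Finset E), Ypot a (ind T) = ∑ e, a e * ind T e := by
    intro a T
    unfold Ypot
    rw [Finset.sum_eq_zero (s := univ) (f := fun e => a e ^ 2 * (ind T e - ind T e ^ 2)),
      mul_zero, add_zero]
    intro e _
    by_cases he : e ∈ T <;> simp [ind, he]
  obtain ⟨p, hp, hpa⟩ := minimax (A := {a : E → ℝ // ∀ e, |a e| ≤ 1 / 18}) (τ := τ)
    (fun a T => Real.exp (Ypot a.1 (ind T.1))) (fun a => Real.exp (Ypot a.1 x)) (by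
      intro J w hw
      obtain ⟨T, h1, h2, h3⟩ := round_exact hex hδ hxR (J.map (Function.Embedding.subtype _))
        (fun a => if h : ∀ e, |a e| ≤ 1 / 18 then w ⟨a, h⟩ else 0) (by
          intro a
          split_ifs
          · exact hw _
          · exact le_rfl) (by
          intro a ha
          rw [Finset.mem_map] at ha
          obtain ⟨a', _, rfl⟩ := ha
          exact a'.2)
      refine ⟨⟨T, h1, h2⟩, ?_⟩
      rw [Finset.sum_map, Finset.sum_map] at h3
      refine le_trans (le_of_eq (Finset.sum_congr rfl fun a _ => ?_))
        (h3.trans (le_of_eq (Finset.sum_congr rfl fun a _ => ?_)))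
      · symm
        exact congrArg (fun z => z * Real.exp (Ypot a.1 (ind T))) (dif_pos a.2)
      · exact congrArg (fun z => z * Real.exp (Ypot a.1 x)) (dif_pos a.2))
  have hsum : ∀ f : Finset E → ℝ,
      ∑ T, (if h : T ∈ B ∧ ind T ∈ Reg B δ b then p ⟨T, h⟩ else 0) * f T =
      ∑ T : τ, p T * f T.1 := by
    intro f
    rw [← Finset.sum_subset (Finset.subset_univ
      (Finset.univ.filter fun T => T ∈ B ∧ ind T ∈ Reg B δ b))]
    · rw [Finset.sum_subtype (p := fun T => T ∈ B ∧ ind T ∈ Reg B δ b) _ (by simp)]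
      refine Finset.sum_congr rfl fun T _ => ?_
      rw [dif_pos T.2]
    · intro T _ hT
      rw [Finset.mem_filter] at hT
      rw [dif_neg (fun h => hT ⟨Finset.mem_univ _, h⟩), zero_mul]
  refine ⟨fun T => if h : T ∈ B ∧ ind T ∈ Reg B δ b then p ⟨T, h⟩ else 0, ⟨?_, ?_⟩, ?_, ?_⟩
  · intro T
    show 0 ≤ dite _ _ _
    split_ifs
    · exact hp.1 _
    · exact le_rfl
  · have := hsum (fun _ => 1)
    simp only [mul_one] at this
    rw [this]
    exact hp.2
  · intro T hT
    have hT2 : T ∈ B ∧ ind T ∈ Reg B δ b := by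
      by_contra h
      exact hT (dif_neg h)
    refine ⟨hT2.1, fun v => ?_⟩
    have hcard : ∑ e ∈ δ v, ind T e = ((T ∩ δ v).card : ℝ) := by
      rw [Finset.inter_comm]
      simp [ind]
    rcases hT2.2.2 v with h | ⟨S, hS1, hS2⟩
    · rw [hcard] at h; linarith
    · have hsub : T ∩ δ v ⊆ S := by
        intro e he
        rw [Finset.mem_inter] at he
        by_contra heS
        have := hS2 e he.2 heS
        simp [ind, he.1] at this
      have h1 : ((T ∩ δ v).card : ℤ) ≤ b v + 2 :=
        le_trans (by exact_mod_cast Finset.card_le_card hsub) hS1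
      exact_mod_cast h1
  · intro a ha
    have h1 := hpa ⟨a, ha⟩
    simp only [hY] at h1
    rw [hsum (fun T => Real.exp (∑ e, a e * ind T e))]
    exact h1
end
end DBST

/-- **Degree-bounded spanning trees (Corollary 5.7).**
There is a universal constant `β ≥ 1` such that: for any finite connected graph `G`,
any point `x` of the spanning tree polytope of `G`, and any integer degree bounds
`b_v` with `Σ_{e ∈ δ(v)} x_e ≤ b_v`, there is a random spanning tree `T` of `G` whose
degrees satisfy `deg_T(v) ≤ b_v + 2` almost surely, with `P[e ∈ T] = x_e` for every
edge, and whose indicator vector is `β`-concentrated around `x`. -/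
theorem degree_bounded_spanning_tree :
    ∃ β : ℝ, 1 ≤ β ∧
      ∀ (V : Type) [Fintype V] [DecidableEq V] (G : SimpleGraph V)
        [DecidableRel G.Adj], G.Connected →
        ∀ (x : Sym2 V → ℝ),
          x ∈ convexHull ℝ {y : Sym2 V → ℝ | ∃ T : Finset (Sym2 V),
            ↑T ⊆ G.edgeSet ∧ (SimpleGraph.fromEdgeSet (↑T : Set (Sym2 V))).IsTree ∧
            y = fun e => if e ∈ T then 1 else 0} →
        ∀ (b : V → ℤ), (∀ v, ∑ e ∈ G.incidenceFinset v, x e ≤ (b v : ℝ)) →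
        ∃ (Ω : Type) (_ : MeasurableSpace Ω) (μ : Measure Ω) (_ : IsProbabilityMeasure μ)
          (T : Ω → Finset (Sym2 V)),
          (∀ e, Measurable fun ω => if e ∈ T ω then (1 : ℝ) else 0) ∧
          (∀ᵐ ω ∂μ, ↑(T ω) ⊆ G.edgeSet ∧
            (SimpleGraph.fromEdgeSet (↑(T ω) : Set (Sym2 V))).IsTree) ∧
          (∀ᵐ ω ∂μ, ∀ v, ((T ω ∩ G.incidenceFinset v).card : ℝ) ≤ (b v : ℝ) + 2) ∧
          (∀ e, (μ {ω | e ∈ T ω}).toReal = x e) ∧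
          IsConcentrated μ (fun ω e => if e ∈ T ω then (1 : ℝ) else 0) x β := by
  classical
  refine ⟨54, by norm_num, ?_⟩
  intro V _ _ G _ _ x hx b hb
  let B : Set (Finset (Sym2 V)) := {T | ↑T ⊆ G.edgeSet ∧
    (SimpleGraph.fromEdgeSet (↑T : Set (Sym2 V))).IsTree}
  have hdiag : ∀ T ∈ B, ∀ e ∈ T, ¬ e.IsDiag := fun T hT e he =>
    G.not_isDiag_of_mem_edgeSet (hT.1 (Finset.mem_coe.2 he))
  have hex : ∀ T₁ ∈ B, ∀ T₂ ∈ B, ∀ a ∈ T₁, a ∉ T₂ → ∃ b ∈ T₂, b ∉ T₁ ∧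
      insert b (T₁.erase a) ∈ B ∧ insert a (T₂.erase b) ∈ B := by
    intro T₁ h₁ T₂ h₂ a ha₁ ha₂
    obtain ⟨b, hb₂, hb₁, k₁, k₂⟩ := DBST.tree_exchange T₁ T₂ (hdiag _ h₁) (hdiag _ h₂)
      h₁.2 h₂.2 a ha₁ ha₂
    refine ⟨b, hb₂, hb₁, ⟨?_, k₁⟩, ⟨?_, k₂⟩⟩
    · intro e he
      rw [Finset.mem_coe, Finset.mem_insert] at he
      rcases he with rfl | he
      · exact h₂.1 (Finset.mem_coe.2 hb₂)
      · exact h₁.1 (Finset.mem_coe.2 (Finset.mem_of_mem_erase he))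
    · intro e he
      rw [Finset.mem_coe, Finset.mem_insert] at he
      rcases he with rfl | he
      · exact h₁.1 (Finset.mem_coe.2 ha₁)
      · exact h₂.1 (Finset.mem_coe.2 (Finset.mem_of_mem_erase he))
  have hδ : ∀ e, #{v | e ∈ G.incidenceFinset v} ≤ 2 := by
    intro e
    induction e with | _ u v => ?_
    refine le_trans (Finset.card_le_card ?_) (Finset.card_le_two (a := u) (b := v))
    intro z hz
    rw [Finset.mem_filter, SimpleGraph.mem_incidenceFinset] at hz
    have := hz.2.2
    rw [Sym2.mem_iff] at this
    simpa using this
  have hxP : x ∈ DBST.Poly B := by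
    refine DBST.convexHull_subset_poly B _ ?_ hx
    rintro y ⟨T, h1, h2, h3⟩
    exact ⟨T, ⟨h1, h2⟩, h3⟩
  obtain ⟨p, hp, hpB, hmgf⟩ := DBST.exists_distribution hex hδ hxP hb
  have hx01 := fun e => DBST.poly_mem_Icc hxP e
  have hmean := DBST.mean_eq p hp (fun T => DBST.ind T)
    (fun T e => ⟨DBST.ind_nonneg T e, DBST.ind_le_one T e⟩) x hx01 hmgf
  have hcher := DBST.chernoff p hp (fun T => DBST.ind T) x hx01 hmgf
  letI : MeasurableSpace (Finset (Sym2 V)) := ⊤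
  let μ : Measure (Finset (Sym2 V)) := ∑ T, ENNReal.ofReal (p T) • Measure.dirac T
  have hμ : ∀ s : Set (Finset (Sym2 V)), μ s = ∑ T, if T ∈ s then ENNReal.ofReal (p T) else 0 := by
    intro s
    simp only [μ, Measure.coe_finset_sum, Finset.sum_apply, Measure.smul_apply, smul_eq_mul]
    refine Finset.sum_congr rfl fun T _ => ?_
    rw [Measure.dirac_apply' _ (MeasurableSpace.measurableSet_top)]
    by_cases h : T ∈ s <;> simp [h]
  have hμr : ∀ s : Set (Finset (Sym2 V)), (μ s).toReal = ∑ T, if T ∈ s then p T else 0 := by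
    intro s
    rw [hμ, ENNReal.toReal_sum]
    · refine Finset.sum_congr rfl fun T _ => ?_
      split_ifs
      · exact ENNReal.toReal_ofReal (hp.1 T)
      · rfl
    · intro T _
      split_ifs
      · exact ENNReal.ofReal_ne_top
      · exact ENNReal.zero_ne_top
  have hprob : IsProbabilityMeasure μ := by
    constructor
    rw [hμ]
    simp only [Set.mem_univ, if_true]
    rw [← ENNReal.ofReal_sum_of_nonneg (fun T _ => hp.1 T), hp.2, ENNReal.ofReal_one]
  have hae : ∀ q : Finset (Sym2 V) → Prop, (∀ T, p T ≠ 0 → q T) → ∀ᵐ T ∂μ, q T := by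
    intro q hq
    rw [ae_iff, hμ]
    refine Finset.sum_eq_zero fun T _ => ?_
    split_ifs with h
    · have : p T = 0 := by
        by_contra h0
        exact h (hq T h0)
      rw [this, ENNReal.ofReal_zero]
    · rfl
  refine ⟨Finset (Sym2 V), ⊤, μ, hprob, fun T => T, ?_, ?_, ?_, ?_, ?_⟩
  · intro e
    exact measurable_from_top
  · exact hae _ fun T hT => (hpB T hT).1
  · exact hae _ fun T hT => (hpB T hT).2
  · intro e
    rw [hμr, ← hmean e]
    refine Finset.sum_congr rfl fun T _ => ?_
    by_cases h : e ∈ T <;> simp [DBST.ind, h]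
  · intro a t ht
    rw [hμr]
    exact hcher a t ht
end

section
/- There exists a universal constant C > 0 such that the following holds. Let G = (L ∪ R, E) be a finite bipartite graph and let x ∈ [0,1]^E be a fractional perfect matching, i.e., Σ_{e ∈ δ(v)} x_e = 1 for every vertex v, where δ(v) is the set of edges incident to v. Then for every 0 < δ < 1 there exists a random matching M of G such that: (i) every vertex v is matched in M with probability at least 1 − δ; (ii) P[e ∈ M] ≥ (1−δ)·x_e for every edge e; and (iii) the indicator vector X ∈ {0,1}^E of M is (C/δ)-concentrated around its mean vector E[X]. -/
open MeasureTheory Finset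

namespace MBM


lemma mgf_center {K : ℕ} (hK : 1 ≤ K) (Y : Fin K → ℝ) (hY : ∑ i, Y i = 0) (D : ℝ)
    (hD : ∀ i j, (Y i - Y j) ^ 2 ≤ D) :
    ∑ i, Real.exp (Y i) ≤ K * Real.exp (D / 2) := by
  have hKr : (0 : ℝ) < K := by exact_mod_cast hK
  have h1 : (K : ℝ) ≤ ∑ j, Real.exp (-Y j) := by
    have : ∑ j : Fin K, (1 - Y j) ≤ ∑ j, Real.exp (-Y j) :=
      Finset.sum_le_sum fun j _ => by linarith [Real.add_one_le_exp (-Y j)]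
    simpa [Finset.sum_sub_distrib, hY] using this
  have hS : (∑ i, Real.exp (Y i)) * (∑ j, Real.exp (-Y j))
      = ∑ i, ∑ j, Real.exp (Y i - Y j) := by
    rw [Finset.sum_mul_sum]
    simp only [← Real.exp_add, sub_eq_add_neg]
  have hS' : ∑ i, ∑ j, Real.exp (Y i - Y j) = ∑ i, ∑ j, Real.exp (-(Y i - Y j)) := by
    rw [Finset.sum_comm]
    simp
  have h2 : ∑ i, ∑ j, Real.exp (Y i - Y j) ≤ K * (K * Real.exp (D / 2)) := by
    have : ∑ i, ∑ j, Real.exp (Y i - Y j) = ∑ i, ∑ j, Real.cosh (Y i - Y j) := by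
      have : ∑ i, ∑ j, Real.cosh (Y i - Y j)
          = (∑ i, ∑ j, Real.exp (Y i - Y j) + ∑ i, ∑ j, Real.exp (-(Y i - Y j))) / 2 := by
        simp only [Real.cosh_eq, ← Finset.sum_add_distrib, Finset.sum_div]
      rw [this, ← hS']; ring
    rw [this]
    have : ∑ i : Fin K, ∑ j : Fin K, Real.cosh (Y i - Y j)
        ≤ ∑ i : Fin K, ∑ j : Fin K, Real.exp (D / 2) := by
      refine Finset.sum_le_sum fun i _ => Finset.sum_le_sum fun j _ => ?_
      refine (Real.cosh_le_exp_half_sq _).trans ?_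
      exact Real.exp_le_exp.2 (by linarith [hD i j])
    simpa using this
  have hpos : 0 ≤ ∑ i, Real.exp (Y i) := Finset.sum_nonneg fun i _ => (Real.exp_pos _).le
  have h3 : (∑ i, Real.exp (Y i)) * K ≤ K * (K * Real.exp (D / 2)) := by
    calc _ ≤ _ := mul_le_mul_of_nonneg_left h1 hpos
      _ = _ := hS
      _ ≤ _ := h2
  nlinarith

lemma windows {T : Type} [Fintype T] [DecidableEq T] (τ : Equiv.Perm T) (K : ℕ) (hK : 1 ≤ K) :
    ∃ S : Finset T, (∀ s ∈ S, ∀ i < K, (τ ^ i) s ∈ S → (τ ^ i) s = s) ∧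
      ∀ e, ∃ i < 2 * K, ∃ s ∈ S, (τ ^ i) s = e := by
  classical
  obtain ⟨S, hS, hmax⟩ := Finset.exists_max_image
    (Finset.univ.filter fun S : Finset T => ∀ s ∈ S, ∀ i < K, (τ ^ i) s ∈ S → (τ ^ i) s = s)
    Finset.card ⟨∅, by simp⟩
  simp only [Finset.mem_filter, Finset.mem_univ, true_and] at hS hmax
  refine ⟨S, hS, fun e => ?_⟩
  obtain ⟨f, hf⟩ : ∃ f, (τ ^ K) f = e := (τ ^ K).surjective e
  by_cases hfS : f ∈ S
  · exact ⟨K, by omega, f, hfS, hf⟩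
  by_contra hcon
  have hins : ∀ s ∈ insert f S, ∀ i < K, (τ ^ i) s ∈ insert f S → (τ ^ i) s = s := by
    intro s hs i hi his
    rw [Finset.mem_insert] at hs his
    rcases hs with rfl | hs
    · rcases his with h | h
      · exact h
      · exfalso
        apply hcon
        refine ⟨K - i, by omega, _, h, ?_⟩
        rw [← hf, ← Equiv.Perm.mul_apply, ← pow_add]
        congr 2; omega
    · rcases his with h | h
      · exfalso
        apply hcon
        refine ⟨K + i, by omega, s, hs, ?_⟩
        rw [pow_add, Equiv.Perm.mul_apply, h, hf]
      · exact hS s hs i hi h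
  have := hmax _ hins
  rw [Finset.card_insert_of_notMem hfS] at this
  omega

lemma windows2 {T : Type} [Fintype T] [DecidableEq T] (τ : Equiv.Perm T) (K : ℕ) (hK : 1 ≤ K) :
    ∃ (pos : T → ℕ) (w : T → T), (∀ e, pos e < 2 * K) ∧ (∀ e, (τ ^ (pos e)) (w e) = e) ∧
      (∀ e, (pos (τ e) = pos e + 1 ∧ w (τ e) = w e) ∨
        (pos (τ e) = 0 ∧ w (τ e) = τ e ∧ (pos e + 1 < K → τ e = w e))) := by
  classical
  obtain ⟨S, hsep, hcov⟩ := windows τ K hK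
  have hcov' : ∀ e, ∃ i, ∃ s ∈ S, (τ ^ i) s = e := fun e => by
    obtain ⟨i, _, h⟩ := hcov e; exact ⟨i, h⟩
  have hw := fun e => Nat.find_spec (hcov' e)
  choose w hwS hwe using hw
  refine ⟨fun e => Nat.find (hcov' e), w, fun e => ?_, hwe, fun e => ?_⟩
  · obtain ⟨i, hi, h⟩ := hcov e
    exact lt_of_le_of_lt (Nat.find_min' _ h) hi
  · by_cases he : τ e ∈ S
    · right
      have h0 : Nat.find (hcov' (τ e)) = 0 := by
        rw [Nat.find_eq_zero]; exact ⟨_, he, rfl⟩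
      refine ⟨h0, ?_, fun hlt => ?_⟩
      · have := hwe (τ e)
        rw [h0] at this
        simpa using this
      · have h1 : (τ ^ (Nat.find (hcov' e) + 1)) (w e) = τ e := by
          rw [pow_succ', Equiv.Perm.mul_apply, hwe]
        have := hsep (w e) (hwS e) _ hlt (by rw [h1]; exact he)
        rw [← this, h1]
    · left
      have h1 : Nat.find (hcov' (τ e)) = Nat.find (hcov' e) + 1 := by
        rw [Nat.find_eq_iff]
        refine ⟨⟨w e, hwS e, ?_⟩, ?_⟩
        · rw [pow_succ', Equiv.Perm.mul_apply, hwe]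
        · rintro n hn ⟨s, hs, hse⟩
          cases n with
          | zero => apply he; rw [← hse]; simpa using hs
          | succ n =>
            refine Nat.find_min (hcov' e) (m := n) (by omega) ⟨s, hs, ?_⟩
            rw [pow_succ', Equiv.Perm.mul_apply] at hse
            exact τ.injective hse
      refine ⟨h1, ?_⟩
      have := hwe (τ e)
      rw [h1, pow_succ', Equiv.Perm.mul_apply] at this
      have h2 := τ.injective this
      rw [← hwe e] at h2
      have h3 : Nat.find (hcov' ((τ ^ Nat.find (hcov' e)) (w e))) = Nat.find (hcov' e) := by
        simp only [hwe]
      exact (τ ^ Nat.find (hcov' e)).injective (by simpa [hwe] using h2)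

/-- Random three-valued labelling along the cycles of a permutation. -/
lemma cyc {T : Type} [Fintype T] [DecidableEq T] (τ : Equiv.Perm T) (K : ℕ) (hK : 1 ≤ K) :
    ∃ (Ω : Type) (_ : Fintype Ω) (wt : Ω → ℝ) (s : Ω → T → ℤ) (p : T → ℝ),
      (∀ ω, 0 ≤ wt ω) ∧ ∑ ω, wt ω = 1 ∧ (∀ e, 1 - 1 / (K : ℝ) ≤ p e ∧ p e ≤ 1) ∧
      (∀ ω e, s ω e = -1 ∨ s ω e = 0 ∨ s ω e = 1) ∧
      (∀ ω e, ¬ (s ω e = -1 ∧ s ω (τ e) = 1)) ∧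
      ∀ g h : T → ℝ, ∑ ω, wt ω *
          Real.exp (∑ e, (g e * (s ω e : ℝ) + h e * (|(s ω e : ℝ)| - p e))) ≤
        Real.exp (2 * K * ∑ e, (g e ^ 2 + h e ^ 2)) := by
  classical
  obtain ⟨pos, w, hpos, hpw, hstep⟩ := windows2 τ K hK
  have hKr : (0 : ℝ) < K := by exact_mod_cast hK
  have : NeZero K := ⟨by omega⟩
  let A : (T → Fin K) → T → T := fun u e =>
    if (u (w e) : ℕ) < pos e then w e else w (τ.symm (w e))
  let cut : (T → Fin K) → T → Prop := fun u e => pos e = (u (w e) : ℕ)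
  let sgn : Bool → ℤ := fun b => if b then 1 else -1
  let s : (T → Fin K) × (T → Bool) → T → ℤ := fun ω e =>
    if cut ω.1 e then 0 else sgn (ω.2 (A ω.1 e))
  let N : ℝ := (K : ℝ) ^ Fintype.card T * 2 ^ Fintype.card T
  have hN : 0 < N := by positivity
  let p : T → ℝ := fun e => if pos e < K then 1 - 1 / (K : ℝ) else 1
  have hsgn : ∀ b, sgn b = -1 ∨ sgn b = 1 := by intro b; cases b <;> simp [sgn]
  have hA : ∀ u e, ∃ i < 4 * K, (τ ^ i) (A u e) = e := by
    intro u e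
    by_cases h : (u (w e) : ℕ) < pos e
    · refine ⟨pos e, by have := hpos e; omega, ?_⟩
      simp only [A, if_pos h]; exact hpw e
    · refine ⟨pos e + 1 + pos (τ.symm (w e)), ?_, ?_⟩
      · have := hpos e; have := hpos (τ.symm (w e)); omega
      · simp only [A, if_neg h]
        rw [pow_add, Equiv.Perm.mul_apply, hpw, pow_succ, Equiv.Perm.mul_apply,
          Equiv.apply_symm_apply, hpw]
  have hcardA : ∀ u v, ((univ.filter fun e => A u e = v).card : ℝ) ≤ 4 * K := by
    intro u v
    have : (univ.filter fun e => A u e = v) ⊆ (range (4 * K)).image fun i => (τ ^ i) v := by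
      intro e he
      simp only [mem_filter, mem_univ, true_and] at he
      obtain ⟨i, hi, h⟩ := hA u e
      rw [he] at h
      exact mem_image.2 ⟨i, mem_range.2 hi, h⟩
    have := (card_le_card this).trans card_image_le
    rw [card_range] at this
    exact_mod_cast this
  have hcardw : ∀ v, ((univ.filter fun e => w e = v).card : ℝ) ≤ 2 * K := by
    intro v
    have : (univ.filter fun e => w e = v) ⊆ (range (2 * K)).image fun i => (τ ^ i) v := by
      intro e he
      simp only [mem_filter, mem_univ, true_and] at he
      exact mem_image.2 ⟨pos e, mem_range.2 (hpos e), by rw [← he]; exact hpw e⟩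
    have := (card_le_card this).trans card_image_le
    rw [card_range] at this
    exact_mod_cast this
  refine ⟨(T → Fin K) × (T → Bool), inferInstance, fun _ => 1 / N, s, p, fun _ => by positivity,
    ?_, ?_, ?_, ?_, ?_⟩
  · simp only [sum_const, card_univ, Fintype.card_prod, nsmul_eq_mul]
    push_cast
    field_simp
    simp [N, Fintype.card_pi]
  · intro e
    have : (0:ℝ) ≤ 1 / K := by positivity
    by_cases h : pos e < K <;> simp only [p, h, if_true, if_false] <;> constructor <;> linarith
  · intro ω e
    by_cases h : cut ω.1 e
    · simp [s, h]
    · simp only [s, h, if_false]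
      rcases hsgn (ω.2 (A ω.1 e)) with h | h <;> simp [h]
  · rintro ⟨u, c⟩ e ⟨h1, h2⟩
    have hc1 : ¬ cut u e := by
      intro h; simp [s, h] at h1
    have hc2 : ¬ cut u (τ e) := by
      intro h; simp [s, h] at h2
    simp only [s, hc1, hc2, if_false] at h1 h2
    have hAA : A u e = A u (τ e) := by
      simp only [cut] at hc1 hc2
      rcases hstep e with ⟨ha, hb⟩ | ⟨ha, hb, hd⟩
      · rw [ha, hb] at hc2
        simp only [A, ha, hb]
        by_cases h : (u (w e) : ℕ) < pos e
        · rw [if_pos h, if_pos (by omega)]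
        · rw [if_neg h, if_neg (by omega)]
      · simp only [A, ha, hb]
        rw [if_neg (by omega : ¬ (u (τ e) : ℕ) < 0), Equiv.symm_apply_apply]
        by_cases h : (u (w e) : ℕ) < pos e
        · rw [if_pos h]
        · rw [if_neg h]
          have : (u (w e) : ℕ) < K := (u (w e)).2
          rw [← hd (by omega), Equiv.symm_apply_apply]
          exact (hd (by omega)).symm
    rw [hAA, h2] at h1
    omega
  · intro g h
    -- coins
    have hcoin : ∀ u : T → Fin K, ∑ c : T → Bool, Real.exp (∑ e, g e * (s (u, c) e : ℝ)) ≤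
        2 ^ Fintype.card T * Real.exp (2 * K * ∑ e, g e ^ 2) := by
      intro u
      let G : T → ℝ := fun v => ∑ e ∈ univ.filter (fun e => A u e = v),
        g e * (if cut u e then 0 else 1)
      have e1 : ∀ c : T → Bool, Real.exp (∑ e, g e * (s (u, c) e : ℝ))
          = ∏ v, Real.exp ((sgn (c v) : ℝ) * G v) := by
        intro c
        rw [← Real.exp_sum]
        congr 1
        simp only [G, Finset.mul_sum]
        rw [← Finset.sum_fiberwise (s := univ) (g := A u)]
        refine sum_congr rfl fun v _ => sum_congr rfl fun e he => ?_
        simp only [mem_filter, mem_univ, true_and] at he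
        by_cases hc : cut u e
        · simp [s, hc]
        · simp only [s, hc, if_false, he]; ring
      simp only [e1]
      have e2 : ∑ c : T → Bool, ∏ v, Real.exp ((sgn (c v) : ℝ) * G v)
          = ∏ v, ∑ b : Bool, Real.exp ((sgn b : ℝ) * G v) := by
        rw [Finset.prod_univ_sum, Fintype.piFinset_univ]
      rw [e2]
      have e3 : ∀ v, ∑ b : Bool, Real.exp ((sgn b : ℝ) * G v) ≤ 2 * Real.exp (G v ^ 2 / 2) := by
        intro v
        have := Real.cosh_le_exp_half_sq (G v)
        rw [Real.cosh_eq] at this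
        simp [sgn]
        linarith
      calc _ ≤ ∏ v : T, 2 * Real.exp (G v ^ 2 / 2) :=
            prod_le_prod (fun v _ => sum_nonneg fun _ _ => (Real.exp_pos _).le) fun v _ => e3 v
        _ = 2 ^ Fintype.card T * Real.exp (∑ v, G v ^ 2 / 2) := by
            rw [prod_mul_distrib, ← Real.exp_sum]; simp
        _ ≤ _ := by
            gcongr
            have e4 : ∀ v, G v ^ 2 / 2 ≤ 2 * K * ∑ e ∈ univ.filter (fun e => A u e = v), g e ^ 2 := by
              intro v
              have h1 : G v ^ 2 ≤ ((univ.filter fun e => A u e = v).card : ℝ) *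
                  ∑ e ∈ univ.filter (fun e => A u e = v),
                  (g e * (if cut u e then 0 else 1)) ^ 2 := sq_sum_le_card_mul_sum_sq
              have h2 : ∑ e ∈ univ.filter (fun e => A u e = v),
                  (g e * (if cut u e then 0 else 1)) ^ 2 ≤
                  ∑ e ∈ univ.filter (fun e => A u e = v), g e ^ 2 := by
                refine sum_le_sum fun e _ => ?_
                split_ifs
                · simp; positivity
                · simp
              have h3 : (0:ℝ) ≤ ∑ e ∈ univ.filter (fun e => A u e = v), g e ^ 2 :=
                sum_nonneg fun _ _ => sq_nonneg _
              have h4 := mul_le_mul_of_nonneg_left h2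
                (Nat.cast_nonneg (α := ℝ) (univ.filter fun e => A u e = v).card)
              have h5 := mul_le_mul_of_nonneg_right (hcardA u v) h3
              linarith
            refine (sum_le_sum fun v _ => e4 v).trans ?_
            rw [← mul_sum, Finset.sum_fiberwise (s := univ) (g := A u)]
    have hcut : ∑ u : T → Fin K, Real.exp (∑ e, h e * ((if cut u e then 0 else 1) - p e)) ≤
        (K : ℝ) ^ Fintype.card T * Real.exp (K * ∑ e, h e ^ 2) := by
      let Y : T → Fin K → ℝ := fun v i => ∑ e ∈ univ.filter (fun e => w e = v),
        h e * ((if pos e = (i : ℕ) then 0 else 1) - p e)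
      have e1 : ∀ u : T → Fin K, Real.exp (∑ e, h e * ((if cut u e then 0 else 1) - p e))
          = ∏ v, Real.exp (Y v (u v)) := by
        intro u
        rw [← Real.exp_sum]
        congr 1
        simp only [Y]
        rw [← Finset.sum_fiberwise (s := univ) (g := w)]
        refine sum_congr rfl fun v _ => sum_congr rfl fun e he => ?_
        simp only [mem_filter, mem_univ, true_and] at he
        simp only [cut, he]
      simp only [e1]
      have e2 : ∑ u : T → Fin K, ∏ v, Real.exp (Y v (u v))
          = ∏ v, ∑ i : Fin K, Real.exp (Y v i) := by
        rw [Finset.prod_univ_sum, Fintype.piFinset_univ]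
      rw [e2]
      have e3 : ∀ v, ∑ i, Real.exp (Y v i) ≤
          K * Real.exp ((2 * K * ∑ e ∈ univ.filter (fun e => w e = v), h e ^ 2) / 2) := by
        intro v
        apply mgf_center hK
        · simp only [Y]
          rw [sum_comm]
          refine sum_eq_zero fun e _ => ?_
          rw [← mul_sum, sum_sub_distrib]
          have : ∑ i : Fin K, (if pos e = (i : ℕ) then (0:ℝ) else 1) = K * p e := by
            by_cases hp : pos e < K
            · have : ∀ i : Fin K, (if pos e = (i : ℕ) then (0:ℝ) else 1)
                  = 1 - if (⟨pos e, hp⟩ : Fin K) = i then 1 else 0 := by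
                intro i
                by_cases hi : pos e = (i : ℕ)
                · have : (⟨pos e, hp⟩ : Fin K) = i := Fin.ext hi
                  simp [hi]
                · have : ¬ (⟨pos e, hp⟩ : Fin K) = i := fun hh => hi (by rw [← hh])
                  simp [hi, this]
              simp only [this, sum_sub_distrib, sum_ite_eq, p, hp]
              simp
              field_simp
            · have : ∀ i : Fin K, (if pos e = (i : ℕ) then (0:ℝ) else 1) = 1 := by
                intro i; rw [if_neg]; have := i.2; omega
              simp [this, p, hp]
          rw [this]; simp
        · intro i j
          have : Y v i - Y v j = ∑ e ∈ univ.filter (fun e => w e = v),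
              h e * ((if pos e = (i : ℕ) then 0 else 1) - (if pos e = (j : ℕ) then 0 else 1)) := by
            simp only [Y]
            rw [← sum_sub_distrib]
            exact sum_congr rfl fun e _ => by ring
          rw [this]
          refine sq_sum_le_card_mul_sum_sq.trans ?_
          refine mul_le_mul (hcardw v) ?_ (sum_nonneg fun _ _ => sq_nonneg _) (by positivity)
          refine sum_le_sum fun e _ => ?_
          rw [mul_pow]
          have := sq_nonneg (h e)
          split_ifs <;> simp <;> linarith
      calc _ ≤ ∏ v : T, (K : ℝ) * Real.exp ((2 * K * ∑ e ∈ univ.filter (fun e => w e = v), h e ^ 2) / 2) :=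
            prod_le_prod (fun v _ => sum_nonneg fun _ _ => (Real.exp_pos _).le) fun v _ => e3 v
        _ = _ := by
            rw [prod_mul_distrib, ← Real.exp_sum]
            simp only [prod_const, card_univ]
            congr 2
            rw [← Finset.sum_fiberwise (s := univ) (g := w) (f := fun e => h e ^ 2), mul_sum]
            exact sum_congr rfl fun v _ => by ring
    have habs : ∀ u c e, |(s (u, c) e : ℝ)| = if cut u e then 0 else 1 := by
      intro u c e
      by_cases hc : cut u e
      · simp [s, hc]
      · simp only [s, hc, if_false]
        rcases hsgn (c (A u e)) with h | h <;> simp [h]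
    rw [← mul_sum, Fintype.sum_prod_type]
    have : ∀ u, ∑ c, Real.exp (∑ e, (g e * (s (u, c) e : ℝ) + h e * (|(s (u, c) e : ℝ)| - p e)))
        ≤ 2 ^ Fintype.card T * Real.exp (2 * K * ∑ e, g e ^ 2) *
          Real.exp (∑ e, h e * ((if cut u e then 0 else 1) - p e)) := by
      intro u
      simp only [sum_add_distrib, Real.exp_add, habs, ← sum_mul]
      exact mul_le_mul_of_nonneg_right (hcoin u) (Real.exp_pos _).le
    calc _ ≤ 1 / N * (2 ^ Fintype.card T * Real.exp (2 * K * ∑ e, g e ^ 2) *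
          ((K : ℝ) ^ Fintype.card T * Real.exp (K * ∑ e, h e ^ 2))) := by
          refine mul_le_mul_of_nonneg_left ?_ (by positivity)
          refine (sum_le_sum fun u _ => this u).trans ?_
          rw [← mul_sum]
          exact mul_le_mul_of_nonneg_left hcut (by positivity)
      _ = Real.exp (2 * K * ∑ e, g e ^ 2 + K * ∑ e, h e ^ 2) := by
          rw [Real.exp_add]
          simp only [N]
          field_simp
      _ ≤ _ := by
          apply Real.exp_le_exp.2
          rw [sum_add_distrib]
          have : 0 ≤ ∑ e, h e ^ 2 := sum_nonneg fun _ _ => sq_nonneg _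
          nlinarith


/-- A side of the orbit structure of two fixed point free involutions. -/
lemma exists_side {H : Type} [Fintype H] (α β : Equiv.Perm H)
    (hα : ∀ e, α (α e) = e) (hβ : ∀ e, β (β e) = e) (hα' : ∀ e, α e ≠ e) (hβ' : ∀ e, β e ≠ e) :
    ∃ T : Set H, (∀ e, e ∈ T ↔ β (α e) ∈ T) ∧ (∀ e, α e ∈ T ↔ e ∉ T) := by
  classical
  set τ : Equiv.Perm H := β * α with hτ
  have hαα : α * α = 1 := Equiv.ext hα
  have hββ : β * β = 1 := Equiv.ext hβ
  have hαi : α⁻¹ = α := inv_eq_of_mul_eq_one_left hαα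
  have hβi : β⁻¹ = β := inv_eq_of_mul_eq_one_left hββ
  have hconj : α * τ * α⁻¹ = τ⁻¹ := by
    rw [hτ, mul_inv_rev, hαi, hβi, mul_assoc, mul_assoc, hαα, mul_one]
  have hconjk : ∀ k : ℤ, ∀ e, α ((τ ^ k) e) = (τ ^ (-k)) (α e) := by
    intro k e
    have h1 : α * τ ^ k * α⁻¹ = (τ⁻¹) ^ k := by rw [← conj_zpow, hconj]
    have h2 : α * τ ^ k = τ ^ (-k) * α := by
      rw [zpow_neg, ← inv_zpow, ← h1]; simp
    exact congrArg (fun f : Equiv.Perm H => f e) h2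
  have hne : ∀ e, ∀ k : ℤ, α e ≠ (τ ^ k) e := by
    intro e k hk
    rcases Int.even_or_odd' k with ⟨m, rfl | rfl⟩
    · apply hα' ((τ ^ m) e)
      rw [hconjk, hk, ← Equiv.Perm.mul_apply, ← zpow_add]
      congr 2; ring
    · apply hβ' (α ((τ ^ m) e))
      have h1 : α ((τ ^ m) e) = τ ((τ ^ m) e) := by
        rw [hconjk, hk, ← Equiv.Perm.mul_apply, ← zpow_add, ← Equiv.Perm.mul_apply,
          ← zpow_one_add]
        congr 2; ring
      have h2 : τ ((τ ^ m) e) = β (α ((τ ^ m) e)) := rfl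
      rw [← h2, h1]
  let Q := Quotient (Equiv.Perm.SameCycle.setoid τ)
  let key : H → Fin (Fintype.card Q) := fun e => Fintype.equivFin Q (Quotient.mk _ e)
  have hkey : ∀ e f, key e = key f ↔ τ.SameCycle e f := by
    intro e f
    simp only [key, EmbeddingLike.apply_eq_iff_eq]
    exact Quotient.eq (r := Equiv.Perm.SameCycle.setoid τ)
  have hk1 : ∀ e, key (τ e) = key e := by
    intro e
    rw [hkey]
    exact ⟨-1, by simp⟩
  have hk2 : ∀ e, key (α (τ e)) = key (α e) := by
    intro e
    rw [hkey]
    refine ⟨1, ?_⟩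
    have := hconjk 1 e
    rw [zpow_one] at this
    rw [this, ← Equiv.Perm.mul_apply, ← zpow_add]; simp
  have hk3 : ∀ e, key e ≠ key (α e) := by
    intro e h
    rw [hkey] at h
    obtain ⟨k, hk⟩ := h
    exact hne e k hk.symm
  refine ⟨{e | key e < key (α e)}, fun e => ?_, fun e => ?_⟩
  · change key e < key (α e) ↔ key (τ e) < key (α (τ e))
    rw [hk1, hk2]
  · change key (α e) < key (α (α e)) ↔ ¬ key e < key (α e)
    rw [hα]
    have := hk3 e
    constructor
    · intro h; exact not_lt.2 h.le
    · intro h; exact lt_of_le_of_ne (not_lt.1 h) this.symm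

lemma pairs0 {H : Type} [Fintype H] (α β : Equiv.Perm H)
    (hα : ∀ e, α (α e) = e) (hβ : ∀ e, β (β e) = e) (hα' : ∀ e, α e ≠ e) (hβ' : ∀ e, β e ≠ e)
    (K : ℕ) (hK : 1 ≤ K) :
    ∃ (Ω : Type) (_ : Fintype Ω) (wt : Ω → ℝ) (σ : Ω → H → ℕ) (ρ : H → ℝ),
      (∀ ω, 0 ≤ wt ω) ∧ ∑ ω, wt ω = 1 ∧ (∀ e, (1 - 1 / (K : ℝ)) / 2 ≤ ρ e ∧ ρ e ≤ 1 / 2) ∧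
      (∀ ω e, σ ω e + σ ω (α e) ≤ 1) ∧ (∀ ω e, σ ω e + σ ω (β e) ≤ 1) ∧
      ∀ b : H → ℝ, ∑ ω, wt ω * Real.exp (∑ e, b e * ((σ ω e : ℝ) - ρ e)) ≤
        Real.exp (K * ∑ e, b e ^ 2) := by
  classical
  obtain ⟨T, hT1, hT2⟩ := exists_side α β hα hβ hα' hβ'
  let τ : Equiv.Perm T := (β * α).subtypePerm fun e => (hT1 e).symm
  obtain ⟨Ω, iΩ, wt, s, p, hwt0, hwt1, hp, hs3, hsτ, hmgf⟩ := cyc τ K hK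
  have hT3 : ∀ e, e ∉ T → α e ∈ T := fun e h => (hT2 e).2 h
  have hT4 : ∀ e, e ∈ T → α e ∉ T := fun e h h' => (hT2 e).1 h' h
  let σ : Ω → H → ℕ := fun ω e =>
    if h : e ∈ T then (if s ω ⟨e, h⟩ = 1 then 1 else 0)
    else (if s ω ⟨α e, hT3 e h⟩ = -1 then 1 else 0)
  let ρ : H → ℝ := fun e =>
    if h : e ∈ T then p ⟨e, h⟩ / 2 else p ⟨α e, hT3 e h⟩ / 2
  have hσT : ∀ ω (e : T), σ ω e = if s ω e = 1 then 1 else 0 := by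
    intro ω e; simp [σ]
  have hσT' : ∀ ω (e : T), σ ω (α e) = if s ω e = -1 then 1 else 0 := by
    intro ω e; simp [σ, hT4 e e.2, hα]
  have hρT : ∀ (e : T), ρ e = p e / 2 := by
    intro e; simp [ρ]
  have hρT' : ∀ (e : T), ρ (α e) = p e / 2 := by
    intro e; simp [ρ, hT4 e e.2, hα]
  have hcase : ∀ e : H, (∃ f : T, e = (f : H)) ∨ ∃ f : T, e = α (f : H) := by
    intro e
    by_cases h : e ∈ T
    · exact Or.inl ⟨⟨e, h⟩, rfl⟩
    · exact Or.inr ⟨⟨α e, hT3 e h⟩, (hα e).symm⟩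
  have hβα : ∀ ω (f : T), σ ω (α f) + σ ω (β (α f)) ≤ 1 := by
    intro ω f
    have h1 : β (α f) = ((τ f : T) : H) := rfl
    rw [h1, hσT, hσT']
    have := hsτ ω f
    by_cases h2 : s ω f = -1
    · have h3 : s ω (τ f) ≠ 1 := fun h => this ⟨h2, h⟩
      simp [h3]; split_ifs <;> simp
    · simp [h2]; split_ifs <;> simp
  have hsum : ∀ F : H → ℝ, ∑ e, F e = ∑ e : T, (F e + F (α e)) := by
    intro F
    rw [sum_add_distrib, ← Fintype.sum_subtype_add_sum_subtype (fun e => e ∈ T) F]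
    congr 1
    symm
    refine Fintype.sum_bijective (fun e : T => (⟨α e, hT4 e e.2⟩ : {x // x ∉ T})) ?_ _ _ ?_
    · constructor
      · intro e f hef
        exact Subtype.ext (α.injective (congrArg Subtype.val hef))
      · intro f
        exact ⟨⟨α f, hT3 f f.2⟩, Subtype.ext (hα f)⟩
    · intro e; rfl
  refine ⟨Ω, iΩ, wt, σ, ρ, hwt0, hwt1, ?_, ?_, ?_, ?_⟩
  · intro e
    rcases hcase e with ⟨f, rfl⟩ | ⟨f, rfl⟩
    · rw [hρT]; have := hp f; constructor <;> linarith
    · rw [hρT']; have := hp f; constructor <;> linarith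
  · intro ω e
    rcases hcase e with ⟨f, rfl⟩ | ⟨f, rfl⟩
    · rw [hσT, hσT']; split_ifs <;> omega
    · rw [hα, hσT, hσT']; split_ifs <;> omega
  · intro ω e
    rcases hcase e with ⟨f, rfl⟩ | ⟨f, rfl⟩
    · have h1 : β f ∉ T := by
        intro h
        have := (hT1 (α (β f))).symm
        rw [hα, hβ] at this
        exact hT4 _ h (this.1 f.2)
      have := hβα ω ⟨α (β f), hT3 _ h1⟩
      simp only [hα, hβ] at this
      omega
    · exact hβα ω f
  · intro b
    have h1 := hmgf (fun e => (b e - b (α e)) / 2) (fun e => (b e + b (α e)) / 2)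
    have e1 : ∀ ω, ∑ e, b e * ((σ ω e : ℝ) - ρ e) = ∑ e : T, ((b e - b (α e)) / 2 * (s ω e : ℝ) +
        (b e + b (α e)) / 2 * (|(s ω e : ℝ)| - p e)) := by
      intro ω
      rw [hsum]
      refine sum_congr rfl fun e _ => ?_
      rw [hσT, hσT', hρT, hρT']
      rcases hs3 ω e with h | h | h <;> simp [h] <;> ring
    simp only [e1]
    refine h1.trans (Real.exp_le_exp.2 (le_of_eq ?_))
    rw [hsum, mul_sum, mul_sum]
    exact sum_congr rfl fun e _ => by ring

lemma pairs {H : Type} [Fintype H] (α β : Equiv.Perm H)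
    (hα : ∀ e, α (α e) = e) (hβ : ∀ e, β (β e) = e)
    (K : ℕ) (hK : 1 ≤ K) :
    ∃ (Ω : Type) (_ : Fintype Ω) (wt : Ω → ℝ) (σ : Ω → H → ℕ) (ρ : H → ℝ),
      (∀ ω, 0 ≤ wt ω) ∧ ∑ ω, wt ω = 1 ∧ (∀ e, (1 - 1 / (K : ℝ)) / 2 ≤ ρ e ∧ ρ e ≤ 1 / 2) ∧
      (∀ ω e, σ ω e ≤ 1) ∧
      (∀ ω e, α e ≠ e → σ ω e + σ ω (α e) ≤ 1) ∧ (∀ ω e, β e ≠ e → σ ω e + σ ω (β e) ≤ 1) ∧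
      ∀ b : H → ℝ, ∑ ω, wt ω * Real.exp (∑ e, b e * ((σ ω e : ℝ) - ρ e)) ≤
        Real.exp (K * ∑ e, b e ^ 2) := by
  classical
  have dbl : ∀ γ : Equiv.Perm H, (∀ e, γ (γ e) = e) → ∃ γ' : Equiv.Perm (H × Bool),
      (∀ x, γ' (γ' x) = x) ∧ (∀ x, γ' x ≠ x) ∧ ∀ e i, γ e ≠ e → γ' (e, i) = (γ e, i) := by
    intro γ hγ
    let f : H × Bool → H × Bool := fun x => if γ x.1 = x.1 then (x.1, !x.2) else (γ x.1, x.2)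
    have hf : Function.Involutive f := by
      rintro ⟨e, i⟩
      by_cases h : γ e = e
      · simp [f, h]
      · have : ¬ e = γ e := fun h' => h h'.symm
        simp [f, h, hγ, this]
    refine ⟨hf.toPerm f, fun x => hf x, ?_, ?_⟩
    · rintro ⟨e, i⟩
      change f (e, i) ≠ (e, i)
      by_cases h : γ e = e
      · simp [f, h]
      · simp [f, h]
    · intro e i h
      change f (e, i) = _
      simp [f, h]
  obtain ⟨α', h1, h2, h3⟩ := dbl α hα
  obtain ⟨β', h4, h5, h6⟩ := dbl β hβ
  obtain ⟨Ω, iΩ, wt, σ, ρ, hwt0, hwt1, hρ, hσα, hσβ, hmgf⟩ := pairs0 α' β' h1 h4 h2 h5 K hK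
  refine ⟨Ω, iΩ, wt, fun ω e => σ ω (e, false), fun e => ρ (e, false), hwt0, hwt1,
    fun e => hρ _, ?_, ?_, ?_, ?_⟩
  · intro ω e; have := hσα ω (e, false); change σ ω (e, false) ≤ 1; omega
  · intro ω e he; have := hσα ω (e, false); rwa [h3 e false he] at this
  · intro ω e he; have := hσβ ω (e, false); rwa [h6 e false he] at this
  · intro b
    have := hmgf (fun x => if x.2 then 0 else b x.1)
    simpa [Fintype.sum_prod_type] using this

lemma exists_pairing {H W : Type} [Fintype H] (f : H → W) :
    ∃ α : Equiv.Perm H, (∀ e, α (α e) = e) ∧ (∀ e, f (α e) = f e) ∧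
      ∀ e e', α e = e → α e' = e' → f e = f e' → e = e' := by
  classical
  obtain ⟨α, hα, hmin⟩ := Finset.exists_min_image
    (univ.filter fun α : Equiv.Perm H => (∀ e, α (α e) = e) ∧ (∀ e, f (α e) = f e))
    (fun α => (univ.filter fun e => α e = e).card) ⟨1, by simp⟩
  simp only [mem_filter, mem_univ, true_and] at hα hmin
  refine ⟨α, hα.1, hα.2, fun e e' he he' hf => ?_⟩
  by_contra hne
  let γ : H → H := fun x => if x = e then e' else if x = e' then e else α x
  have hαe : ∀ x, α x = e ↔ x = e := fun x =>
    ⟨fun h => by rw [← hα.1 x, h, he], fun h => by rw [h, he]⟩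
  have hαe' : ∀ x, α x = e' ↔ x = e' := fun x =>
    ⟨fun h => by rw [← hα.1 x, h, he'], fun h => by rw [h, he']⟩
  have hγ : Function.Involutive γ := by
    intro x
    by_cases h1 : x = e
    · have : ¬ e' = e := fun h => hne h.symm
      simp [γ, h1, this]
    · by_cases h2 : x = e'
      · simp [γ, h2]
      · simp [γ, h1, h2, hαe, hαe', hα.1]
  have h := hmin (hγ.toPerm γ) ⟨fun x => hγ x, fun x => by
    change f (γ x) = f x
    by_cases h1 : x = e
    · simp [γ, h1, hf]
    · by_cases h2 : x = e'
      · have : ¬ e' = e := fun h => hne h.symm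
        simp [γ, h2, hf, this]
      · simp [γ, h1, h2, hα.2]⟩
  have hlt : (univ.filter fun x => γ x = x).card < (univ.filter fun x => α x = x).card := by
    apply card_lt_card
    rw [ssubset_iff_of_subset]
    · refine ⟨e, by simp [he], ?_⟩
      simp [γ]; exact fun h => hne h.symm
    · intro x
      simp only [mem_filter, mem_univ, true_and]
      intro hx
      by_cases h1 : x = e
      · rw [h1, he]
      · by_cases h2 : x = e'
        · rw [h2, he']
        · simpa [γ, h1, h2] using hx
  exact absurd h (not_le.2 hlt)

/-- `y` is the mean of a random matching (of the bipartite multigraph with edge set `E` and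
end point maps `l`, `r`) satisfying a Bernstein-type bound on its exponential moments. -/
def Good {E W : Type} [Fintype E] (l r : E → W) (R V : ℝ) (y : E → ℝ) : Prop :=
  ∃ (Ω : Type) (_ : Fintype Ω) (wt : Ω → ℝ) (M : Ω → Finset E),
    (∀ ω, 0 ≤ wt ω) ∧ ∑ ω, wt ω = 1 ∧
    (∀ ω, ∀ e ∈ M ω, ∀ f ∈ M ω, l e = l f ∨ r e = r f → e = f) ∧
    ∀ a : E → ℝ, (∀ e, |a e| ≤ R) → ∑ ω, wt ω * Real.exp (∑ e ∈ M ω, a e) ≤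
      Real.exp (∑ e, (a e * y e + V * a e ^ 2 * (y e - y e ^ 2)))

lemma exp_quad {t : ℝ} (ht : |t| ≤ 1) : Real.exp t ≤ 1 + t + t ^ 2 := by
  have := (abs_le.1 (Real.abs_exp_sub_one_sub_id_le ht)).2
  linarith

lemma scalar_down {V a y s : ℝ} (hV : 4 ≤ V) (ha : V * |a| ≤ 1) (hy0 : 0 ≤ y) (hy1 : y ≤ 1)
    (hs0 : 0 ≤ s) (hs1 : s ≤ 1) :
    s * Real.exp (a * y + V * a ^ 2 * (y - y ^ 2)) + (1 - s) ≤
      Real.exp (a * (s * y) + V * a ^ 2 * (s * y - (s * y) ^ 2)) := by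
  set g : ℝ := a * y + V * a ^ 2 * (y - y ^ 2) with hg
  have hk : |1 + V * a * (1 - y)| ≤ 2 := by
    have h1 : |V * a * (1 - y)| ≤ 1 := by
      rw [abs_mul, abs_mul, abs_of_nonneg (by linarith : (0:ℝ) ≤ V),
        abs_of_nonneg (by linarith : (0:ℝ) ≤ 1 - y)]
      have : 0 ≤ V * |a| := by positivity
      nlinarith
    rw [abs_le] at h1 ⊢
    constructor <;> linarith
  have hg' : g = (a * y) * (1 + V * a * (1 - y)) := by rw [hg]; ring
  have hg2 : g ^ 2 ≤ 4 * (a ^ 2 * y ^ 2) := by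
    have h2 : (1 + V * a * (1 - y)) ^ 2 ≤ 4 := by
      rw [← sq_abs]; nlinarith [abs_nonneg (1 + V * a * (1 - y))]
    rw [hg', mul_pow]
    nlinarith [sq_nonneg (a * y)]
  have ha4 : |a| ≤ 1 / 4 := by
    have := abs_nonneg a
    nlinarith
  have hg1 : |g| ≤ 1 := by
    rw [hg', abs_mul, abs_mul, abs_of_nonneg hy0]
    have h3 : |a| * y ≤ 1 / 4 := by nlinarith [abs_nonneg a]
    have h4 : 0 ≤ |a| * y := by positivity
    nlinarith [abs_nonneg (1 + V * a * (1 - y))]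
  have e1 : Real.exp (g * (1 - s)) ≤ 1 + g * (1 - s) + (g * (1 - s)) ^ 2 := by
    apply exp_quad
    rw [abs_mul, abs_of_nonneg (by linarith : (0:ℝ) ≤ 1 - s)]
    nlinarith [abs_nonneg g]
  have e2 : Real.exp (-(g * s)) ≤ 1 + -(g * s) + (-(g * s)) ^ 2 := by
    apply exp_quad
    rw [abs_neg, abs_mul, abs_of_nonneg hs0]
    nlinarith [abs_nonneg g]
  have e3 : s * Real.exp (g * (1 - s)) + (1 - s) * Real.exp (-(g * s)) ≤
      Real.exp (g ^ 2 * s * (1 - s)) := by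
    have h5 := mul_le_mul_of_nonneg_left e1 hs0
    have h6 := mul_le_mul_of_nonneg_left e2 (by linarith : (0:ℝ) ≤ 1 - s)
    have h7 := Real.add_one_le_exp (g ^ 2 * s * (1 - s))
    nlinarith
  calc s * Real.exp g + (1 - s)
      = Real.exp (g * s) * (s * Real.exp (g * (1 - s)) + (1 - s) * Real.exp (-(g * s))) := by
        have h8 : Real.exp g = Real.exp (g * s) * Real.exp (g * (1 - s)) := by
          rw [← Real.exp_add]; congr 1; ring
        have h9 : Real.exp (g * s) * Real.exp (-(g * s)) = 1 := by
          rw [← Real.exp_add]; simp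
        rw [h8]
        linear_combination -(1 - s) * h9
    _ ≤ Real.exp (g * s) * Real.exp (g ^ 2 * s * (1 - s)) :=
        mul_le_mul_of_nonneg_left e3 (Real.exp_pos _).le
    _ = Real.exp (g * s + g ^ 2 * s * (1 - s)) := (Real.exp_add _ _).symm
    _ ≤ _ := by
        apply Real.exp_le_exp.2
        have h10 : 0 ≤ s * (1 - s) := mul_nonneg hs0 (by linarith)
        have h11 : g ^ 2 ≤ V * (a ^ 2 * y ^ 2) := by nlinarith [mul_nonneg (sq_nonneg a) (sq_nonneg y)]
        have h12 := mul_le_mul_of_nonneg_right h11 h10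
        rw [hg] at h12 ⊢
        nlinarith

section
variable {E W : Type} [Fintype E] {l r : E → W} {R V : ℝ}

open Classical in
lemma Good.down_one {y : E → ℝ} (hy : Good l r R V y) (hV : 4 ≤ V) (hR : V * R ≤ 1)
    (e0 : E) (h0 : 0 ≤ y e0) (h1 : y e0 ≤ 1) {s : ℝ} (hs0 : 0 ≤ s) (hs1 : s ≤ 1) :
    Good l r R V (Function.update y e0 (s * y e0)) := by
  obtain ⟨Ω, iΩ, wt, M, hwt0, hwt1, hM, hmgf⟩ := hy
  refine ⟨Ω × Bool, inferInstance, fun x => (if x.2 then s else 1 - s) * wt x.1,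
    fun x => if x.2 then M x.1 else (M x.1).erase e0, ?_, ?_, ?_, ?_⟩
  · rintro ⟨ω, b⟩
    have := hwt0 ω
    cases b
    · simp only [Bool.false_eq_true, if_false]; exact mul_nonneg (by linarith) this
    · simp only [if_true]; exact mul_nonneg hs0 this
  · rw [Fintype.sum_prod_type]
    simp only [Fintype.sum_bool, if_true, Bool.false_eq_true, if_false]
    refine Eq.trans (sum_congr rfl fun ω _ => ?_) hwt1
    ring
  · rintro ⟨ω, b⟩
    cases b
    · intro e he f hf
      exact hM ω e (mem_of_mem_erase he) f (mem_of_mem_erase hf)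
    · exact hM ω
  · intro a ha
    have hR0 : 0 ≤ R := (abs_nonneg _).trans (ha e0)
    have k1 := hmgf a ha
    have k2 := hmgf (Function.update a e0 0) (fun e => by
      by_cases h : e = e0
      · subst h; simpa using hR0
      · simpa [h] using ha e)
    have hM2 : ∀ ω, ∑ e ∈ M ω, Function.update a e0 0 e = ∑ e ∈ (M ω).erase e0, a e := by
      intro ω
      by_cases h : e0 ∈ M ω
      · rw [← Finset.add_sum_erase _ _ h]
        simp only [Function.update_self, zero_add]
        exact sum_congr rfl fun e he => by simp [ne_of_mem_erase he]
      · rw [erase_eq_of_notMem h]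
        refine sum_congr rfl fun e he => ?_
        have : e ≠ e0 := fun h' => h (h' ▸ he)
        simp [this]
    simp only [hM2] at k2
    let P : ℝ := ∑ e ∈ univ.erase e0, (a e * y e + V * a e ^ 2 * (y e - y e ^ 2))
    have s1 : ∑ e, (a e * y e + V * a e ^ 2 * (y e - y e ^ 2)) =
        P + (a e0 * y e0 + V * a e0 ^ 2 * (y e0 - y e0 ^ 2)) := by
      rw [← Finset.sum_erase_add _ _ (mem_univ e0)]
    have s2 : ∑ e, (Function.update a e0 0 e * y e +
        V * Function.update a e0 0 e ^ 2 * (y e - y e ^ 2)) = P := by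
      rw [← Finset.sum_erase_add _ _ (mem_univ e0)]
      simp only [Function.update_self]
      have : ∀ e ∈ univ.erase e0, (Function.update a e0 0 e * y e +
        V * Function.update a e0 0 e ^ 2 * (y e - y e ^ 2)) =
          (a e * y e + V * a e ^ 2 * (y e - y e ^ 2)) := fun e he => by
        simp [ne_of_mem_erase he]
      rw [sum_congr rfl this]; simp [P]
    have s3 : ∑ e, (a e * Function.update y e0 (s * y e0) e +
        V * a e ^ 2 * (Function.update y e0 (s * y e0) e - Function.update y e0 (s * y e0) e ^ 2))
        = P + (a e0 * (s * y e0) + V * a e0 ^ 2 * (s * y e0 - (s * y e0) ^ 2)) := by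
      rw [← Finset.sum_erase_add _ _ (mem_univ e0)]
      simp only [Function.update_self]
      congr 1
      refine sum_congr rfl fun e he => by
        simp [ne_of_mem_erase he]
    rw [s1] at k1
    rw [s2] at k2
    rw [s3, Real.exp_add]
    rw [Real.exp_add] at k1
    have hsc := scalar_down hV (a := a e0) (y := y e0) (s := s)
      (by have := ha e0; nlinarith) h0 h1 hs0 hs1
    rw [Fintype.sum_prod_type]
    simp only [Fintype.sum_bool, if_true, Bool.false_eq_true, if_false, sum_add_distrib]
    simp only [mul_assoc, ← mul_sum]
    have k3 := mul_le_mul_of_nonneg_left k1 hs0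
    have k4 := mul_le_mul_of_nonneg_left k2 (by linarith : 0 ≤ 1 - s)
    have k5 := mul_le_mul_of_nonneg_left hsc (Real.exp_pos P).le
    simp only [mul_assoc] at k3 k4 k5 ⊢
    linarith

lemma Good.down {y y' : E → ℝ} (hy : Good l r R V y) (hV : 4 ≤ V) (hR : V * R ≤ 1)
    (h0 : ∀ e, 0 ≤ y' e) (hle : ∀ e, y' e ≤ y e) (h1 : ∀ e, y e ≤ 1) :
    Good l r R V y' := by
  classical
  have key : ∀ F : Finset E, Good l r R V (fun e => if e ∈ F then y' e else y e) := by
    intro F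
    induction F using Finset.induction_on with
    | empty => simpa using hy
    | insert e0 F he0 ih =>
      have hy0 : 0 ≤ y e0 := (h0 e0).trans (hle e0)
      have := ih.down_one hV hR e0 (by simpa [he0] using hy0) (by simpa [he0] using h1 e0)
        (s := y' e0 / y e0) (div_nonneg (h0 e0) hy0) (div_le_one_of_le₀ (hle e0) hy0)
      convert this using 1
      funext e
      by_cases h : e = e0
      · subst h
        simp only [mem_insert_self, if_true, Function.update_self, he0, if_false]
        by_cases hz : y e = 0
        · have := hle e; have := h0 e; rw [hz]; simp; linarith
        · field_simp
      · simp [h]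
  simpa using key univ

open Classical in
lemma load_bound {n : E → ℕ} {f : E → W} (α : Equiv.Perm {e // n e % 2 = 1})
    (hα : ∀ e, α (α e) = e) (hf : ∀ e, f (α e) = f e)
    (hfix : ∀ e e', α e = e → α e' = e' → f e = f e' → e = e')
    (σ : {e // n e % 2 = 1} → ℕ) (hσ1 : ∀ e, σ e ≤ 1) (hσ : ∀ e, α e ≠ e → σ e + σ (α e) ≤ 1)
    (B : ℕ) (v : W) (hB : ∑ e with f e = v, n e ≤ 2 * B) :
    ∑ e with f e = v, (n e / 2 + if h : n e % 2 = 1 then σ ⟨e, h⟩ else 0) ≤ B := by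
  have hsub : ∀ F : E → ℕ, (∀ e, ¬ n e % 2 = 1 → F e = 0) →
      ∑ e, F e = ∑ e : {e // n e % 2 = 1}, F e := by
    intro F hF
    rw [← Fintype.sum_subtype_add_sum_subtype (fun e => n e % 2 = 1) F]
    rw [add_eq_left]
    exact sum_eq_zero fun e _ => hF e e.2
  have h1 : ∑ e with f e = v, n e = 2 * ∑ e with f e = v, n e / 2 +
      ∑ e : {e // n e % 2 = 1}, if f e = v then 1 else 0 := by
    rw [mul_sum, sum_filter, sum_filter]
    rw [← hsub (fun e => if f e = v ∧ n e % 2 = 1 then 1 else 0) (by simp +contextual) |>.trans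
      (sum_congr rfl fun e _ => by simp [e.2]), ← sum_add_distrib]
    refine sum_congr rfl fun e _ => ?_
    by_cases h : f e = v
    · simp only [h, if_true, true_and]; split_ifs <;> omega
    · simp [h]
  have h2 : ∑ e with f e = v, (if h : n e % 2 = 1 then σ ⟨e, h⟩ else 0) =
      ∑ e : {e // n e % 2 = 1}, if f e = v then σ e else 0 := by
    rw [sum_filter, hsub _ (by intro e he; simp [he])]
    exact sum_congr rfl fun e _ => by simp [e.2]
  have h3 : (∑ e : {e // n e % 2 = 1}, if f e = v then σ e else 0) =
      ∑ e : {e // n e % 2 = 1}, if f e = v then σ (α e) else 0 := by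
    rw [← Equiv.sum_comp α]
    exact sum_congr rfl fun e _ => by rw [hf]
  have h4 : (∑ e : {e // n e % 2 = 1}, if f e = v ∧ α e = e then 1 else 0) ≤ 1 := by
    rw [← card_filter, card_le_one]
    intro a ha b hb
    simp only [mem_filter, mem_univ, true_and] at ha hb
    exact hfix a b ha.2 hb.2 (ha.1.trans hb.1.symm)
  have h5 : (∑ e : {e // n e % 2 = 1}, if f e = v then σ e else 0) +
      (∑ e : {e // n e % 2 = 1}, if f e = v then σ (α e) else 0) ≤
      (∑ e : {e // n e % 2 = 1}, if f e = v then 1 else 0) +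
      ∑ e : {e // n e % 2 = 1}, if f e = v ∧ α e = e then 1 else 0 := by
    rw [← sum_add_distrib, ← sum_add_distrib]
    refine sum_le_sum fun e _ => ?_
    by_cases h : f e = v
    · by_cases h' : α e = e
      · have := hσ1 e; simp [h, h']; omega
      · have := hσ e h'; simp [h, h']; omega
    · simp [h]
  rw [sum_add_distrib, h2]
  omega
end

lemma scalar_step {V V' a q m ρ k : ℝ} (hV : 4 ≤ V) (ha : V * |a| ≤ 1) (hq : 0 < q)
    (hm : 0 ≤ m) (hqm : q * (m + 1) ≤ 1) (hρ : 1 / 4 ≤ ρ) (hρ' : ρ ≤ 1 / 2) (hk : 0 ≤ k)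
    (hV' : V + 32 * k * q ≤ V') :
    a * (q * m) + V * a ^ 2 * (q * m - (q * m) ^ 2) +
      (q * a + V * a ^ 2 * (q - q ^ 2 * (2 * m + 1))) * ρ +
      k * (q * a + V * a ^ 2 * (q - q ^ 2 * (2 * m + 1))) ^ 2 ≤
    a * (q * (m + ρ)) + V' * a ^ 2 * (q * (m + ρ) - (q * (m + ρ)) ^ 2) := by
  have hb : (q * a + V * a ^ 2 * (q - q ^ 2 * (2 * m + 1))) ^ 2 ≤ 4 * q ^ 2 * a ^ 2 := by
    have h1 : |1 - q * (2 * m + 1)| ≤ 1 := by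
      have : 0 ≤ q * m := by positivity
      rw [abs_le]; constructor <;> nlinarith
    have h2 : |V * a * (1 - q * (2 * m + 1))| ≤ 1 := by
      rw [abs_mul, abs_mul, abs_of_nonneg (by linarith : (0:ℝ) ≤ V)]
      have : 0 ≤ V * |a| := by positivity
      nlinarith [abs_nonneg (1 - q * (2 * m + 1))]
    have h3 : (1 + V * a * (1 - q * (2 * m + 1))) ^ 2 ≤ 4 := by
      rw [abs_le] at h2; nlinarith
    have h4 : q * a + V * a ^ 2 * (q - q ^ 2 * (2 * m + 1)) =
      (q * a) * (1 + V * a * (1 - q * (2 * m + 1))) := by ring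
    rw [h4, mul_pow]
    nlinarith [sq_nonneg (q * a)]
  set w : ℝ := q * (m + ρ) with hw
  have hw1 : q / 4 ≤ w := by rw [hw]; nlinarith [mul_nonneg hq.le hm]
  have hw2 : q / 2 ≤ 1 - w := by rw [hw]; nlinarith
  have hww : q / 8 ≤ w - w ^ 2 := by
    rcases le_total w (1 / 2) with h | h
    · nlinarith
    · nlinarith
  have hkb := mul_le_mul_of_nonneg_left hb hk
  have h5 : 32 * k * q * (a ^ 2 * (q / 8)) ≤ 32 * k * q * (a ^ 2 * (w - w ^ 2)) := by
    gcongr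
  have h6 : (V + 32 * k * q) * (a ^ 2 * (w - w ^ 2)) ≤ V' * (a ^ 2 * (w - w ^ 2)) := by
    refine mul_le_mul_of_nonneg_right hV' (mul_nonneg (sq_nonneg _) (by linarith))
  have h7 : 0 ≤ V * a ^ 2 * (q ^ 2 * (ρ - ρ ^ 2)) := by
    have : 0 ≤ ρ - ρ ^ 2 := by nlinarith
    positivity
  have h8 : a * (q * m) + V * a ^ 2 * (q * m - (q * m) ^ 2) +
      (q * a + V * a ^ 2 * (q - q ^ 2 * (2 * m + 1))) * ρ =
      a * w + V * a ^ 2 * (w - w ^ 2) - V * a ^ 2 * (q ^ 2 * (ρ - ρ ^ 2)) := by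
    rw [hw]; ring
  rw [h8]
  nlinarith

open Classical in
lemma step {E W : Type} [Fintype E] {l r : E → W} {R V V' q : ℝ} {B K : ℕ}
    (hK : 2 ≤ K) (hV : 4 ≤ V) (hVR : V * R ≤ 1) (hq : 0 < q) (hqB : q * B ≤ 1)
    (hV' : V + 32 * K * q ≤ V')
    (ih : ∀ m : E → ℕ, (∀ v, ∑ e with l e = v, m e ≤ B) → (∀ v, ∑ e with r e = v, m e ≤ B) →
      Good l r R V (fun e => q * m e))
    (n : E → ℕ) (hl : ∀ v, ∑ e with l e = v, n e ≤ 2 * B)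
    (hr : ∀ v, ∑ e with r e = v, n e ≤ 2 * B) :
    ∃ w : E → ℝ, Good l r R V' w ∧ (∀ e, (1 - 1 / (K : ℝ)) * (q / 2 * n e) ≤ w e) ∧
      ∀ e, w e ≤ 1 := by
  obtain ⟨α, hα, hαf, hαfix⟩ := exists_pairing (fun e : {e // n e % 2 = 1} => l e)
  obtain ⟨β, hβ, hβf, hβfix⟩ := exists_pairing (fun e : {e // n e % 2 = 1} => r e)
  obtain ⟨Ω, iΩ, wt, σ, ρ, hwt0, hwt1, hρ, hσ1, hσα, hσβ, hmgf⟩ :=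
    pairs α β hα hβ K (by omega)
  have hKr : (2 : ℝ) ≤ K := by exact_mod_cast hK
  have hK1 : 1 / (K : ℝ) ≤ 1 / 2 := by
    apply one_div_le_one_div_of_le <;> linarith
  let σ' : Ω → E → ℕ := fun ω e => if h : n e % 2 = 1 then σ ω ⟨e, h⟩ else 0
  let ρ' : E → ℝ := fun e => if h : n e % 2 = 1 then ρ ⟨e, h⟩ else 0
  let m : E → ℕ := fun e => n e / 2
  have hgood : ∀ ω, Good l r R V (fun e => q * ((m e + σ' ω e : ℕ) : ℝ)) := fun ω =>
    ih _ (fun v => load_bound α hα hαf hαfix (σ ω) (hσ1 ω) (hσα ω) B v (hl v))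
      (fun v => load_bound β hβ hβf hβfix (σ ω) (hσ1 ω) (hσβ ω) B v (hr v))
  have hnB : ∀ e, n e ≤ 2 * B := by
    intro e
    refine le_trans ?_ (hl (l e))
    exact single_le_sum (f := n) (fun _ _ => Nat.zero_le _) (by simp)
  have hsub : ∀ F : E → ℝ, (∀ e, ¬ n e % 2 = 1 → F e = 0) →
      ∑ e, F e = ∑ e : {e // n e % 2 = 1}, F e := by
    intro F hF
    rw [← Fintype.sum_subtype_add_sum_subtype (fun e => n e % 2 = 1) F]
    rw [add_eq_left]
    exact sum_eq_zero fun e _ => hF e e.2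
  have hm1 : ∀ e, n e % 2 = 1 → q * ((m e : ℝ) + 1) ≤ 1 := by
    intro e he
    have : m e + 1 ≤ B := by have := hnB e; simp only [m]; omega
    have : (m e : ℝ) + 1 ≤ B := by exact_mod_cast this
    nlinarith
  have hm0 : ∀ e, q * (m e : ℝ) ≤ 1 := by
    intro e
    have : m e ≤ B := by have := hnB e; simp only [m]; omega
    have : (m e : ℝ) ≤ B := by exact_mod_cast this
    nlinarith
  refine ⟨fun e => q * (m e + ρ' e), ?_, ?_, ?_⟩
  · choose Ω2 iΩ2 wt2 M h20 h21 hM hmgf2 using hgood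
    refine ⟨Σ ω, Ω2 ω, inferInstance, fun x => wt x.1 * wt2 x.1 x.2, fun x => M x.1 x.2,
      fun x => mul_nonneg (hwt0 _) (h20 _ _), ?_, fun x => hM _ _, ?_⟩
    · rw [Fintype.sum_sigma]
      simp only [← mul_sum, h21, mul_one, hwt1]
    · intro a ha
      rw [Fintype.sum_sigma]
      simp only [mul_assoc, ← mul_sum]
      let b : E → ℝ := fun e => q * a e + V * a e ^ 2 * (q - q ^ 2 * (2 * (m e : ℝ) + 1))
      let C : ℝ := ∑ e, (a e * (q * m e) + V * a e ^ 2 * (q * m e - (q * m e) ^ 2) + b e * ρ' e)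
      have e1 : ∀ ω, ∑ e, (a e * (q * ((m e + σ' ω e : ℕ) : ℝ)) +
          V * a e ^ 2 * (q * ((m e + σ' ω e : ℕ) : ℝ) - (q * ((m e + σ' ω e : ℕ) : ℝ)) ^ 2)) =
          C + ∑ e : {e // n e % 2 = 1}, b e * ((σ ω e : ℝ) - ρ e) := by
        intro ω
        have e2 : ∑ e : {e // n e % 2 = 1}, b e * ((σ ω e : ℝ) - ρ e) =
            ∑ e, b e * ((σ' ω e : ℝ) - ρ' e) := by
          rw [hsub]
          · exact sum_congr rfl fun e _ => by simp [σ', ρ', e.2]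
          · intro e he; simp [σ', ρ', he]
        rw [e2, ← sum_add_distrib]
        refine sum_congr rfl fun e _ => ?_
        have e3 : (σ' ω e : ℝ) ^ 2 = σ' ω e := by
          have : σ' ω e ≤ 1 := by
            by_cases h : n e % 2 = 1
            · simp only [σ', h, dif_pos]; exact hσ1 _ _
            · simp [σ', h]
          interval_cases σ' ω e <;> simp
        simp only [b]
        push_cast
        linear_combination (-(V * a e ^ 2 * q ^ 2)) * e3
      have e4 : ∀ ω, ∑ i, wt2 ω i * Real.exp (∑ e ∈ M ω i, a e) ≤
          Real.exp C * Real.exp (∑ e : {e // n e % 2 = 1}, b e * ((σ ω e : ℝ) - ρ e)) := by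
        intro ω
        have := hmgf2 ω a ha
        rwa [e1, Real.exp_add] at this
      have e5 : ∑ ω, wt ω * ∑ i, wt2 ω i * Real.exp (∑ e ∈ M ω i, a e) ≤
          Real.exp C * Real.exp (K * ∑ e : {e // n e % 2 = 1}, b e ^ 2) := by
        refine (sum_le_sum fun ω _ => mul_le_mul_of_nonneg_left (e4 ω) (hwt0 ω)).trans ?_
        have := mul_le_mul_of_nonneg_left (hmgf fun e => b e) (Real.exp_pos C).le
        refine le_trans (le_of_eq ?_) this
        rw [mul_sum]
        exact sum_congr rfl fun ω _ => by ring
      refine e5.trans ?_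
      rw [← Real.exp_add]
      apply Real.exp_le_exp.2
      have e6 : ∑ e : {e // n e % 2 = 1}, b e ^ 2 = ∑ e, if n e % 2 = 1 then b e ^ 2 else 0 := by
        rw [hsub]
        · exact sum_congr rfl fun e _ => by simp [e.2]
        · intro e he; simp [he]
      rw [e6, mul_sum, ← sum_add_distrib]
      refine sum_le_sum fun e _ => ?_
      have hae : V * |a e| ≤ 1 := by have := ha e; nlinarith
      by_cases h : n e % 2 = 1
      · simp only [h, if_true, ρ', dif_pos, b]
        have h9 := hρ ⟨e, h⟩
        have h13 := scalar_step hV hae hq (Nat.cast_nonneg _) (hm1 e h) (by linarith) h9.2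
          (by positivity) hV'
        linarith
      · simp only [h, if_false, ρ', dif_neg, mul_zero, add_zero, not_false_eq_true]
        have h10 : 0 ≤ q * (m e : ℝ) := by positivity
        have h11 : 0 ≤ a e ^ 2 * (q * m e - (q * m e) ^ 2) := by
          have := hm0 e
          exact mul_nonneg (sq_nonneg _) (by nlinarith)
        have h12 : V ≤ V' := by
          have : 0 ≤ 32 * (K : ℝ) * q := by positivity
          linarith
        nlinarith
  · intro e
    have hn : (n e : ℝ) = 2 * m e + (n e % 2 : ℕ) := by
      have : n e = 2 * m e + n e % 2 := by simp only [m]; omega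
      exact_mod_cast this
    have hmq : 0 ≤ q * (m e : ℝ) := by positivity
    have hk0 : 0 ≤ 1 / (K : ℝ) := by positivity
    rw [hn]
    by_cases h : n e % 2 = 1
    · have h9 := (hρ ⟨e, h⟩).1
      simp only [ρ', h, dif_pos]
      push_cast
      nlinarith
    · have h' : n e % 2 = 0 := by omega
      simp only [ρ', h']
      simp
      rw [one_div] at hk0
      nlinarith [mul_nonneg hk0 hmq]
  · intro e
    by_cases h : n e % 2 = 1
    · have h9 := (hρ ⟨e, h⟩).2
      have := hm1 e h
      simp only [ρ', h, dif_pos]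
      nlinarith
    · simp only [ρ', h, dif_neg, not_false_eq_true, add_zero]
      exact hm0 e

open Classical in
lemma all_levels {E W : Type} [Fintype E] {l r : E → W} {R : ℝ} {N : ℕ} (hN : 1 ≤ N)
    (hR0 : 0 ≤ R) (hR : (4 + 512 * N) * R ≤ 1) (j : ℕ) :
    ∀ n : E → ℕ, (∀ v, ∑ e with l e = v, n e ≤ 2 ^ j) → (∀ v, ∑ e with r e = v, n e ≤ 2 ^ j) →
      Good l r R (4 + 32 * N * (16 - (2 * (j : ℝ) ^ 2 + 10 * j + 16) / 2 ^ j))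
        (fun e => (1 - 1 / (N : ℝ) * (1 - 1 / ((j : ℝ) + 1))) / 2 ^ j * n e) := by
  have hNr : (1 : ℝ) ≤ N := by exact_mod_cast hN
  induction j with
  | zero =>
    intro n hl hr
    have hn : ∀ e, n e ≤ 1 := by
      intro e
      refine le_trans ?_ (hl (l e))
      exact single_le_sum (f := n) (fun _ _ => Nat.zero_le _) (by simp)
    have huniq : ∀ f : E → W, (∀ v, ∑ e with f e = v, n e ≤ 2 ^ 0) → ∀ e e', n e = 1 →
        n e' = 1 → f e = f e' → e = e' := by
      intro f hf e e' he he' hee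
      by_contra hne
      have h1 := hf (f e)
      have h2 : ∑ x ∈ ({e, e'} : Finset E), n x ≤ ∑ x with f x = f e, n x := by
        apply sum_le_sum_of_subset
        intro x hx
        simp only [mem_insert, mem_singleton] at hx
        rcases hx with rfl | rfl <;> simp [hee]
      rw [sum_pair hne, he, he'] at h2
      omega
    refine ⟨Unit, inferInstance, fun _ => 1, fun _ => univ.filter fun e => n e = 1,
      fun _ => zero_le_one, by simp, ?_, ?_⟩
    · intro _ e he f hf h
      simp only [mem_filter, mem_univ, true_and] at he hf
      rcases h with h | h
      · exact huniq l hl e f he hf h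
      · exact huniq r hr e f he hf h
    · intro a _
      simp only [univ_unique, sum_const, card_singleton, one_smul, one_mul]
      apply Real.exp_le_exp.2
      rw [sum_filter]
      refine le_of_eq (sum_congr rfl fun e _ => ?_)
      have := hn e
      interval_cases h : n e <;> simp
  | succ j ih =>
    intro n hl hr
    set θ : ℝ := 1 - 1 / (N : ℝ) * (1 - 1 / ((j : ℝ) + 1)) with hθ
    have hj0 : (0 : ℝ) ≤ j := Nat.cast_nonneg j
    have hN1 : 1 / (N : ℝ) ≤ 1 := by rw [div_le_one (by linarith)]; exact hNr
    have hN0 : 0 < 1 / (N : ℝ) := by positivity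
    have hj1 : 1 / ((j : ℝ) + 1) ≤ 1 := by rw [div_le_one (by linarith)]; linarith
    have hj2 : 0 < 1 / ((j : ℝ) + 1) := by positivity
    have hθ1 : θ ≤ 1 := by
      rw [hθ]; nlinarith
    have hθ0 : 0 < θ := by
      rw [hθ]; nlinarith
    let K : ℕ := N * ((j + 1) * (j + 2))
    have hKr : (K : ℝ) = N * ((j + 1) * (j + 2)) := by simp only [K]; push_cast; ring
    have hK : 2 ≤ K := by
      have h : 2 ≤ (j + 1) * (j + 2) := by nlinarith
      have := Nat.mul_le_mul hN h
      simp only [K]; omega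
    have hp : (0 : ℝ) < 2 ^ j := by positivity
    have hVmono : ∀ i : ℕ, (4 : ℝ) + 32 * N * (16 - (2 * (i : ℝ) ^ 2 + 10 * i + 16) / 2 ^ i) ≤
        4 + 512 * N := by
      intro i
      have : 0 ≤ (2 * (i : ℝ) ^ 2 + 10 * i + 16) / 2 ^ i := by positivity
      nlinarith
    have hV4 : ∀ i : ℕ, (4 : ℝ) ≤ 4 + 32 * N * (16 - (2 * (i : ℝ) ^ 2 + 10 * i + 16) / 2 ^ i) := by
      intro i
      have h1 : (2 * (i : ℝ) ^ 2 + 10 * i + 16) / 2 ^ i ≤ 16 := by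
        rw [div_le_iff₀ (by positivity)]
        have : 2 * i ^ 2 + 10 * i + 16 ≤ 16 * 2 ^ i := by
          induction i with
          | zero => simp
          | succ i ih => rw [pow_succ 2 i]; nlinarith
        exact_mod_cast this
      have : 0 ≤ 32 * (N : ℝ) * (16 - (2 * (i : ℝ) ^ 2 + 10 * i + 16) / 2 ^ i) :=
        mul_nonneg (by positivity) (by linarith)
      linarith
    have hVR : ∀ i : ℕ, (4 + 32 * N * (16 - (2 * (i : ℝ) ^ 2 + 10 * i + 16) / 2 ^ i)) * R ≤ 1 :=
      fun i => (mul_le_mul_of_nonneg_right (hVmono i) hR0).trans hR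
    obtain ⟨w, hw, hw1, hw2⟩ := step (l := l) (r := r) (R := R)
      (V := 4 + 32 * N * (16 - (2 * (j : ℝ) ^ 2 + 10 * j + 16) / 2 ^ j))
      (V' := 4 + 32 * N * (16 - (2 * ((j + 1 : ℕ) : ℝ) ^ 2 + 10 * ((j + 1 : ℕ) : ℝ) + 16) / 2 ^ (j + 1)))
      (q := θ / 2 ^ j) (B := 2 ^ j) (K := K) hK (hV4 j) (hVR j) (by positivity)
      (by push_cast; field_simp; exact hθ1)
      (by
        have h1 : 32 * (K : ℝ) * (θ / 2 ^ j) ≤ 32 * K * (1 / 2 ^ j) := by gcongr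
        refine (add_le_add_right h1 _).trans (le_of_eq ?_)
        rw [hKr, pow_succ]
        push_cast
        field_simp
        ring)
      ih n (fun v => by have := hl v; rwa [pow_succ, mul_comm] at this)
      (fun v => by have := hr v; rwa [pow_succ, mul_comm] at this)
    have hθ'0 : (0:ℝ) ≤ 1 - 1 / (N : ℝ) * (1 - 1 / (((j + 1 : ℕ) : ℝ) + 1)) := by
      have h1 : 1 / (((j + 1 : ℕ) : ℝ) + 1) ≤ 1 := by
        rw [div_le_one (by positivity)]; push_cast; linarith
      have h2 : 0 < 1 / (((j + 1 : ℕ) : ℝ) + 1) := by positivity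
      nlinarith
    refine hw.down (hV4 _) (hVR _) (fun e => by positivity) (fun e => ?_) hw2
    refine le_trans ?_ (hw1 e)
    have h3 : 1 - 1 / (N : ℝ) * (1 - 1 / (((j + 1 : ℕ) : ℝ) + 1)) ≤ (1 - 1 / (K : ℝ)) * θ := by
      have h4 : 1 - 1 / (N : ℝ) * (1 - 1 / (((j + 1 : ℕ) : ℝ) + 1)) = θ - 1 / (K : ℝ) := by
        rw [hθ, hKr]; push_cast; field_simp; ring
      have h5 : 0 ≤ 1 / (K : ℝ) := by positivity
      rw [h4]; nlinarith
    have h6 : (1 - 1 / (K : ℝ)) * (θ / 2 ^ j / 2 * n e) =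
        ((1 - 1 / (K : ℝ)) * θ) / 2 ^ (j + 1) * n e := by
      rw [pow_succ]; field_simp
    rw [h6]
    gcongr

section final

lemma mean_eq {E Ω : Type} [Fintype E] [DecidableEq E] [Fintype Ω] {wt : Ω → ℝ} {M : Ω → Finset E} {R V : ℝ}
    {y : E → ℝ} (hwt0 : ∀ ω, 0 ≤ wt ω) (hwt1 : ∑ ω, wt ω = 1) (hR : 0 < R)
    (hmgf : ∀ a : E → ℝ, (∀ e, |a e| ≤ R) → ∑ ω, wt ω * Real.exp (∑ e ∈ M ω, a e) ≤
      Real.exp (∑ e, (a e * y e + V * a e ^ 2 * (y e - y e ^ 2)))) (e : E) :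
    ∑ ω with e ∈ M ω, wt ω = y e := by
  set p : ℝ := ∑ ω with e ∈ M ω, wt ω with hp
  have key : ∀ t : ℝ, |t| ≤ R →
      1 + t * p ≤ Real.exp (t * y e + V * t ^ 2 * (y e - y e ^ 2)) := by
    intro t ht
    have h := hmgf (fun f => if f = e then t else 0) (by
      intro f
      by_cases hf : f = e
      · simpa [hf] using ht
      · simpa [hf] using hR.le)
    have h2 : ∑ f, ((if f = e then t else 0) * y f +
        V * (if f = e then t else 0) ^ 2 * (y f - y f ^ 2)) =
        t * y e + V * t ^ 2 * (y e - y e ^ 2) := by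
      rw [sum_eq_single e]
      · simp
      · intro b _ hb; simp [hb]
      · simp
    rw [h2] at h
    refine le_trans ?_ h
    have h3 : 1 + t * p = ∑ ω, wt ω * (1 + ∑ f ∈ M ω, if f = e then t else 0) := by
      simp only [mul_add, mul_one, sum_add_distrib, hwt1]
      rw [hp, sum_filter, mul_sum]
      congr 1
      refine sum_congr rfl fun ω _ => ?_
      by_cases hω : e ∈ M ω <;> simp [hω, mul_comm]
    rw [h3]
    refine sum_le_sum fun ω _ => mul_le_mul_of_nonneg_left ?_ (hwt0 ω)
    have := Real.add_one_le_exp (∑ f ∈ M ω, if f = e then t else 0)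
    linarith
  have hmin : IsLocalMin
      (fun t : ℝ => Real.exp (t * y e + V * t ^ 2 * (y e - y e ^ 2)) - (1 + t * p)) 0 := by
    filter_upwards [Metric.ball_mem_nhds (0 : ℝ) hR] with t ht
    have ht' : |t| ≤ R := by
      rw [Metric.mem_ball, Real.dist_eq, sub_zero] at ht; exact ht.le
    have := key t ht'
    simp
    linarith
  have hd : HasDerivAt
      (fun t : ℝ => Real.exp (t * y e + V * t ^ 2 * (y e - y e ^ 2)) - (1 + t * p))
      (y e - p) 0 := by
    have h1 : HasDerivAt (fun t : ℝ => t * y e + V * t ^ 2 * (y e - y e ^ 2)) (y e) 0 := by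
      have := ((hasDerivAt_id (0 : ℝ)).mul_const (y e)).add
        ((((hasDerivAt_id (0 : ℝ)).pow 2).const_mul V).mul_const (y e - y e ^ 2))
      exact this.congr_deriv (by simp)
    have h2 : HasDerivAt (fun t : ℝ => 1 + t * p) p 0 := by
      have := ((hasDerivAt_id (0 : ℝ)).mul_const p).const_add 1
      exact this.congr_deriv (by simp)
    have := h1.exp.sub h2
    exact this.congr_deriv (by simp)
  have := hmin.hasDerivAt_eq_zero hd
  linarith

open Classical in
lemma tail {E Ω : Type} [Fintype E] [Fintype Ω] {wt : Ω → ℝ} {M : Ω → Finset E} {V β : ℝ}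
    {y : E → ℝ} (hwt0 : ∀ ω, 0 ≤ wt ω) (hwt1 : ∑ ω, wt ω = 1) (hV : 0 < V)
    (hβ : 3 * V ≤ β) (hy0 : ∀ e, 0 ≤ y e) (hy1 : ∀ e, y e ≤ 1)
    (hmgf : ∀ a : E → ℝ, (∀ e, |a e| ≤ 1 / V) → ∑ ω, wt ω * Real.exp (∑ e ∈ M ω, a e) ≤
      Real.exp (∑ e, (a e * y e + V * a e ^ 2 * (y e - y e ^ 2))))
    (a : E → ℝ) (A : ℝ) (hA0 : 0 ≤ A) (hA : ∀ e, |a e| ≤ A) (t : ℝ) (ht : 0 < t) :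
    ∑ ω with t ≤ ∑ e ∈ M ω, a e - ∑ e, a e * y e, wt ω ≤
      Real.exp (-(t ^ 2 / β) / (2 * (∑ e, a e ^ 2 * (y e - y e ^ 2) + A * t / 3))) := by
  set s : ℝ := ∑ e, a e ^ 2 * (y e - y e ^ 2) with hs
  have hs0 : 0 ≤ s := sum_nonneg fun e _ => mul_nonneg (sq_nonneg _) (by
    have := hy0 e; have := hy1 e; nlinarith)
  rcases hA0.eq_or_lt with h | hApos
  · have ha : ∀ e, a e = 0 := fun e => by
      have := hA e; rw [← h] at this; exact abs_nonpos_iff.1 this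
    have : s = 0 := by rw [hs]; simp [ha]
    rw [this, ← h]
    simp only [zero_mul, zero_div, add_zero, mul_zero, div_zero, Real.exp_zero]
    rw [← hwt1]
    exact sum_le_sum_of_subset_of_nonneg (filter_subset _ _) fun ω _ _ => hwt0 ω
  have hAt : 0 < A * t := by positivity
  set D : ℝ := 2 * s + A * t with hD
  have hD0 : 0 < D := by linarith
  set c : ℝ := t / (V * D) with hc
  have hc0 : 0 < c := by positivity
  have hcA : c * A ≤ 1 / V := by
    rw [hc, div_mul_eq_mul_div, div_le_div_iff₀ (by positivity) hV]
    nlinarith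
  have h1 := hmgf (fun e => c * a e) (fun e => by
    rw [abs_mul, abs_of_pos hc0]
    exact (mul_le_mul_of_nonneg_left (hA e) hc0.le).trans hcA)
  have h2 : ∑ e, (c * a e * y e + V * (c * a e) ^ 2 * (y e - y e ^ 2)) =
      c * ∑ e, a e * y e + V * c ^ 2 * s := by
    rw [hs, mul_sum, mul_sum, ← sum_add_distrib]
    exact sum_congr rfl fun e _ => by ring
  rw [h2] at h1
  set m : ℝ := ∑ e, a e * y e with hm
  have h3 : (∑ ω with t ≤ ∑ e ∈ M ω, a e - m, wt ω) * Real.exp (c * (t + m)) ≤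
      ∑ ω, wt ω * Real.exp (∑ e ∈ M ω, c * a e) := by
    rw [sum_mul]
    refine le_trans (sum_le_sum fun ω hω => ?_)
      (sum_le_sum_of_subset_of_nonneg (filter_subset _ _)
        fun ω _ _ => mul_nonneg (hwt0 ω) (Real.exp_pos _).le)
    refine mul_le_mul_of_nonneg_left (Real.exp_le_exp.2 ?_) (hwt0 ω)
    rw [← mul_sum]
    have := (mem_filter.1 hω).2
    exact mul_le_mul_of_nonneg_left (by linarith) hc0.le
  have h4 : (∑ ω with t ≤ ∑ e ∈ M ω, a e - m, wt ω) ≤ Real.exp (V * c ^ 2 * s - c * t) := by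
    have h5 := h3.trans h1
    rw [← le_div_iff₀ (Real.exp_pos _), ← Real.exp_sub] at h5
    have h7 : V * c ^ 2 * s - c * t = c * m + V * c ^ 2 * s - c * (t + m) := by ring
    rw [h7]; exact h5
  refine h4.trans (Real.exp_le_exp.2 ?_)
  have h6 : V * c ^ 2 * s - c * t ≤ -(t ^ 2 / (2 * (V * D))) := by
    have : V * c ^ 2 * s - c * t = -(t ^ 2 / (2 * (V * D))) - t ^ 2 / (2 * (V * D)) * (A * t / D) := by
      rw [hc]
      have : s = (D - A * t) / 2 := by rw [hD]; ring
      rw [this]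
      field_simp
      ring
    rw [this]
    have : 0 ≤ t ^ 2 / (2 * (V * D)) * (A * t / D) := by positivity
    linarith
  refine h6.trans ?_
  have hβ0 : 0 < β := by linarith
  rw [neg_div, neg_le_neg_iff, div_div]
  refine div_le_div_of_nonneg_left (by positivity) (by positivity) ?_
  have : V * D ≤ β * (s + A * t / 3) := by
    calc V * D ≤ 3 * V * (s + A * t / 3) := by rw [hD]; nlinarith
      _ ≤ _ := mul_le_mul_of_nonneg_right hβ (by positivity)
  linarith

open Classical in
lemma final_good {E W : Type} [Fintype E] {l r : E → W} {x : E → ℝ} (hx0 : ∀ e, 0 ≤ x e)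
    (hl : ∀ v, ∑ e with l e = v, x e ≤ 1) (hr : ∀ v, ∑ e with r e = v, x e ≤ 1)
    {δ : ℝ} (hδ0 : 0 < δ) (hδ1 : δ < 1) :
    ∃ (V V' : ℝ) (y : E → ℝ), 0 < V ∧ 3 * V ≤ 4620 / δ ∧ V' ≤ V ∧ Good l r (1 / V) V' y ∧
      (∀ e, (1 - δ) * x e ≤ y e) ∧ ∀ e, x e = 0 → y e = 0 := by
  set N : ℕ := ⌈2 / δ⌉₊ with hN
  have hN1 : 2 / δ ≤ N := Nat.le_ceil _
  have hN2 : (N : ℝ) < 2 / δ + 1 := Nat.ceil_lt_add_one (by positivity)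
  have hd1 : 1 ≤ 1 / δ := by rw [le_div_iff₀ hδ0]; linarith
  have h2d : 2 / δ = 2 * (1 / δ) := by ring
  have hNr : (1 : ℝ) ≤ N := by linarith
  have hNn : 1 ≤ N := by exact_mod_cast hNr
  obtain ⟨j, hj⟩ : ∃ j : ℕ, (Fintype.card E : ℝ) / (δ / 2) ≤ 2 ^ j := by
    obtain ⟨j, hj⟩ := pow_unbounded_of_one_lt ((Fintype.card E : ℝ) / (δ / 2))
      (by norm_num : (1 : ℝ) < 2)
    exact ⟨j, hj.le⟩
  rw [div_le_iff₀ (by positivity)] at hj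
  let n : E → ℕ := fun e => ⌈(2 : ℝ) ^ j * (1 - δ / 2) * x e⌉₊
  have hn1 : ∀ e, (2 : ℝ) ^ j * (1 - δ / 2) * x e ≤ n e := fun e => Nat.le_ceil _
  have hp : (0 : ℝ) < 2 ^ j := by positivity
  have hq : (0 : ℝ) < 1 - δ / 2 := by linarith
  have hn2 : ∀ e, (n e : ℝ) ≤ (2 : ℝ) ^ j * (1 - δ / 2) * x e + 1 := fun e =>
    (Nat.ceil_lt_add_one (by have := hx0 e; positivity)).le
  have load : ∀ f : E → W, (∀ v, ∑ e with f e = v, x e ≤ 1) →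
      ∀ v, ∑ e with f e = v, n e ≤ 2 ^ j := by
    intro f hf v
    have h1 : (∑ e with f e = v, (n e : ℝ)) ≤ 2 ^ j := by
      calc (∑ e with f e = v, (n e : ℝ))
          ≤ ∑ e with f e = v, ((2 : ℝ) ^ j * (1 - δ / 2) * x e + 1) :=
            sum_le_sum fun e _ => hn2 e
        _ = (2 : ℝ) ^ j * (1 - δ / 2) * (∑ e with f e = v, x e)
              + ((univ.filter fun e => f e = v).card : ℝ) := by
            rw [sum_add_distrib, mul_sum]; simp
        _ ≤ (2 : ℝ) ^ j * (1 - δ / 2) * 1 + Fintype.card E := by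
            refine add_le_add (mul_le_mul_of_nonneg_left (hf v) (by positivity)) ?_
            exact_mod_cast card_le_univ _
        _ ≤ 2 ^ j := by nlinarith
    exact_mod_cast h1
  have hVb : (0 : ℝ) < 4 + 512 * N := by positivity
  refine ⟨4 + 512 * N, _, _, hVb, ?_, ?_, all_levels (l := l) (r := r) (R := 1 / (4 + 512 * N))
    hNn (by positivity) (by field_simp; exact le_refl _) j n (load l hl) (load r hr), ?_, ?_⟩
  · have : 4620 / δ = 4620 * (1 / δ) := by ring
    rw [this]; linarith
  · have : 0 ≤ (2 * (j : ℝ) ^ 2 + 10 * j + 16) / 2 ^ j := by positivity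
    nlinarith
  · intro e
    have hθ : 1 - δ / 2 ≤ 1 - 1 / (N : ℝ) * (1 - 1 / ((j : ℝ) + 1)) := by
      have h1 : 1 / (N : ℝ) ≤ δ / 2 := by
        rw [div_le_div_iff₀ (by linarith) (by norm_num)]
        rw [div_le_iff₀ hδ0] at hN1
        linarith
      have h2 : 0 ≤ 1 / ((j : ℝ) + 1) := by positivity
      have h3 : 0 ≤ 1 / (N : ℝ) := by positivity
      nlinarith
    have hxe := hx0 e
    calc (1 - δ) * x e ≤ (1 - δ / 2) / 2 ^ j * ((2 : ℝ) ^ j * (1 - δ / 2) * x e) := by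
          have : (1 - δ / 2) / 2 ^ j * ((2 : ℝ) ^ j * (1 - δ / 2) * x e) =
            (1 - δ / 2) ^ 2 * x e := by field_simp
          rw [this]
          exact mul_le_mul_of_nonneg_right (by nlinarith) hxe
      _ ≤ (1 - δ / 2) / 2 ^ j * n e := mul_le_mul_of_nonneg_left (hn1 e) (by positivity)
      _ ≤ _ := by
          refine mul_le_mul_of_nonneg_right ?_ (Nat.cast_nonneg _)
          exact div_le_div_of_nonneg_right hθ hp.le
  · intro e he
    simp [n, he]

open Classical in
lemma exists_measure {Ω : Type} [Fintype Ω] {wt : Ω → ℝ} (hwt0 : ∀ ω, 0 ≤ wt ω)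
    (hwt1 : ∑ ω, wt ω = 1) :
    ∃ μ : @Measure Ω ⊤, @IsProbabilityMeasure Ω ⊤ μ ∧
      ∀ S : Set Ω, (μ S).toReal = ∑ ω with ω ∈ S, wt ω := by
  let _ : MeasurableSpace Ω := ⊤
  let μ : Measure Ω := ∑ ω, ENNReal.ofReal (wt ω) • Measure.dirac ω
  have hμ : ∀ S : Set Ω, μ S = ENNReal.ofReal (∑ ω with ω ∈ S, wt ω) := by
    intro S
    have hS : MeasurableSet S := trivial
    simp only [μ, Measure.finsetSum_apply, Measure.smul_apply, smul_eq_mul,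
      Measure.dirac_apply' _ hS]
    rw [sum_filter, ENNReal.ofReal_sum_of_nonneg]
    · refine sum_congr rfl fun ω _ => ?_
      by_cases h : ω ∈ S <;> simp [h]
    · intro ω _
      split_ifs
      · exact hwt0 ω
      · exact le_refl _
  refine ⟨μ, ⟨?_⟩, fun S => ?_⟩
  · rw [hμ]; simp [hwt1]
  · rw [hμ, ENNReal.toReal_ofReal]
    exact sum_nonneg fun ω _ => hwt0 ω

end final

end MBM

/-- **Multi-budgeted bipartite matching (Theorem 5.8, Chekuri–Vondrák–Zenklusen).**
There is a universal constant `C > 0` such that: for any finite bipartite graph `G`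
(i.e. `2`-colorable), any fractional perfect matching `x` of `G`, and any `0 < δ < 1`,
there is a random matching `M` of `G` in which every vertex is matched with
probability at least `1 − δ`, every edge `e` belongs to `M` with probability at least
`(1−δ)·x_e`, and whose indicator vector is `(C/δ)`-concentrated around its mean. -/
theorem multibudgeted_bipartite_matching :
    ∃ C : ℝ, 0 < C ∧
      ∀ (V : Type) [Fintype V] [DecidableEq V] (G : SimpleGraph V)
        [DecidableRel G.Adj], G.Colorable 2 →
        ∀ (x : Sym2 V → ℝ), (∀ e, x e ∈ Set.Icc (0 : ℝ) 1) →
          (∀ e, e ∉ G.edgeSet → x e = 0) →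
          (∀ v, ∑ e ∈ G.incidenceFinset v, x e = 1) →
        ∀ (δ : ℝ), 0 < δ → δ < 1 →
        ∃ (Ω : Type) (_ : MeasurableSpace Ω) (μ : Measure Ω) (_ : IsProbabilityMeasure μ)
          (Mch : Ω → Finset (Sym2 V)),
          (∀ e, Measurable fun ω => if e ∈ Mch ω then (1 : ℝ) else 0) ∧
          (∀ᵐ ω ∂μ, ↑(Mch ω) ⊆ G.edgeSet ∧
            ∀ e ∈ Mch ω, ∀ f ∈ Mch ω, e ≠ f → ∀ v : V, ¬(v ∈ e ∧ v ∈ f)) ∧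
          (∀ v : V, 1 - δ ≤ (μ {ω | ∃ e ∈ Mch ω, v ∈ e}).toReal) ∧
          (∀ e, (1 - δ) * x e ≤ (μ {ω | e ∈ Mch ω}).toReal) ∧
          IsConcentrated μ (fun ω e => if e ∈ Mch ω then (1 : ℝ) else 0)
            (fun e => ∫ ω, (if e ∈ Mch ω then (1 : ℝ) else 0) ∂μ) (C / δ) := by
  refine ⟨4620, by norm_num, ?_⟩
  intro V _ _ G _ hcol x hx01 hxG hxv δ hδ0 hδ1
  obtain ⟨col⟩ := hcol
  have hends : ∀ e : Sym2 V, ∃ u v : V, e ∈ G.edgeSet → e = s(u, v) ∧ col u = 0 ∧ col v = 1 := by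
    intro e
    induction e using Sym2.ind with
    | _ u v =>
      by_cases h : s(u, v) ∈ G.edgeSet
      · have hadj : G.Adj u v := h
        have hne := col.valid hadj
        by_cases hu : col u = 0
        · exact ⟨u, v, fun _ => ⟨rfl, hu, by omega⟩⟩
        · exact ⟨v, u, fun _ => ⟨Sym2.eq_swap, by omega, by omega⟩⟩
      · exact ⟨u, v, fun h' => absurd h' h⟩
  choose l r hlr using hends
  have hx0 : ∀ e, 0 ≤ x e := fun e => (hx01 e).1
  have load : ∀ f : Sym2 V → V, (∀ e ∈ G.edgeSet, f e ∈ e) →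
      ∀ v, (∑ e with f e = v, x e) ≤ 1 := by
    intro f hf v
    rw [← hxv v, ← sum_filter_ne_zero]
    refine sum_le_sum_of_subset_of_nonneg ?_ fun e _ _ => hx0 e
    intro e he
    simp only [mem_filter, mem_univ, true_and] at he
    have heG : e ∈ G.edgeSet := by
      by_contra h; exact he.2 (hxG e h)
    rw [SimpleGraph.mem_incidenceFinset]
    exact ⟨heG, he.1 ▸ hf e heG⟩
  have hle : ∀ e ∈ G.edgeSet, l e ∈ e := fun e he => by
    have h := (hlr e he).1
    have : l e ∈ s(l e, r e) := Sym2.mem_mk_left _ _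
    rwa [← h] at this
  have hre : ∀ e ∈ G.edgeSet, r e ∈ e := fun e he => by
    have h := (hlr e he).1
    have : r e ∈ s(l e, r e) := Sym2.mem_mk_right _ _
    rwa [← h] at this
  obtain ⟨Vb, V', y, hVb, hVb3, hV', ⟨Ω, iΩ, wt, M, hwt0, hwt1, hM, hmgf⟩, hxy, hy00⟩ :=
    MBM.final_good (l := l) (r := r) hx0 (fun v => by convert load l hle v)
      (fun v => by convert load r hre v) hδ0 hδ1
  classical
  have hmean : ∀ e, ∑ ω with e ∈ M ω, wt ω = y e := fun e => by
    rw [← MBM.mean_eq hwt0 hwt1 (by positivity : 0 < 1 / Vb) hmgf e]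
  have hy0 : ∀ e, 0 ≤ y e := fun e => by
    rw [← hmean e]; exact sum_nonneg fun ω _ => hwt0 ω
  have hy1 : ∀ e, y e ≤ 1 := fun e => by
    rw [← hmean e, ← hwt1]
    exact sum_le_sum_of_subset_of_nonneg (filter_subset _ _) fun ω _ _ => hwt0 ω
  have hmgf' : ∀ a : Sym2 V → ℝ, (∀ e, |a e| ≤ 1 / Vb) →
      ∑ ω, wt ω * Real.exp (∑ e ∈ M ω, a e) ≤
      Real.exp (∑ e, (a e * y e + Vb * a e ^ 2 * (y e - y e ^ 2))) := by
    intro a ha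
    refine (hmgf a ha).trans (Real.exp_le_exp.2 (sum_le_sum fun e _ => ?_))
    have h1 : 0 ≤ a e ^ 2 * (y e - y e ^ 2) := mul_nonneg (sq_nonneg _) (by
      have := hy0 e; have := hy1 e; nlinarith)
    nlinarith
  have hedge : ∀ ω, wt ω ≠ 0 → ∀ e ∈ M ω, e ∈ G.edgeSet := by
    intro ω hω e he
    by_contra h
    have h1 := hmean e
    rw [hy00 e (hxG e h), sum_eq_zero_iff_of_nonneg fun ω _ => hwt0 ω] at h1
    exact hω (h1 ω (by simpa using he))
  have hmatch : ∀ ω, wt ω ≠ 0 → ∀ e ∈ M ω, ∀ f ∈ M ω, ∀ v : V, v ∈ e → v ∈ f → e = f := by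
    intro ω hω e he f hf v hve hvf
    obtain ⟨e1, e2, e3⟩ := hlr e (hedge ω hω e he)
    obtain ⟨f1, f2, f3⟩ := hlr f (hedge ω hω f hf)
    apply hM ω e he f hf
    rw [e1, Sym2.mem_iff] at hve
    rw [f1, Sym2.mem_iff] at hvf
    rcases hve with h | h <;> rcases hvf with h' | h'
    · left; rw [← h, ← h']
    · rw [← h] at e2; rw [← h', e2] at f3; exact absurd f3 (by decide)
    · rw [← h'] at f2; rw [← h, f2] at e3; exact absurd e3 (by decide)
    · right; rw [← h, ← h']
  obtain ⟨μ, hμp, hμ⟩ := MBM.exists_measure hwt0 hwt1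
  let _ : MeasurableSpace Ω := ⊤
  have hprob : ∀ e, (μ {ω | e ∈ M ω}).toReal = y e := fun e => by
    rw [hμ, ← hmean e]; simp
  have hintegral : ∀ e, ∫ ω, (if e ∈ M ω then (1 : ℝ) else 0) ∂μ = y e := by
    intro e
    have : (fun ω => if e ∈ M ω then (1 : ℝ) else 0) = Set.indicator {ω | e ∈ M ω} 1 := by
      ext ω; simp [Set.indicator]
    rw [this, integral_indicator_one (by trivial)]
    exact hprob e
  refine ⟨Ω, ⊤, μ, hμp, M, fun e => measurable_from_top, ?_, ?_, ?_, ?_⟩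
  · have h0 : μ {ω | wt ω = 0} = 0 := by
      have h1 : (μ {ω | wt ω = 0}).toReal = 0 := by
        rw [hμ]
        exact sum_eq_zero fun ω hω => (mem_filter.1 hω).2
      exact ((ENNReal.toReal_eq_zero_iff _).1 h1).resolve_right (measure_ne_top μ _)
    have h2 : ∀ᵐ ω ∂μ, wt ω ≠ 0 := by
      rw [ae_iff]; simpa using h0
    filter_upwards [h2] with ω hω
    exact ⟨fun e he => hedge ω hω e he, fun e he f hf hne v hv =>
      hne (hmatch ω hω e he f hf v hv.1 hv.2)⟩
  · intro v
    rw [hμ]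
    have h1 : (1 - δ) * ∑ e ∈ G.incidenceFinset v, x e ≤
        ∑ e ∈ G.incidenceFinset v, ∑ ω with e ∈ M ω, wt ω := by
      rw [mul_sum]
      exact sum_le_sum fun e _ => by rw [hmean e]; exact hxy e
    rw [hxv v, mul_one] at h1
    refine h1.trans ?_
    simp only [sum_filter]
    rw [sum_comm]
    refine sum_le_sum fun ω _ => ?_
    by_cases hω : wt ω = 0
    · simp [hω]
    · rw [← sum_filter, sum_const, nsmul_eq_mul]
      have hcard : ((G.incidenceFinset v).filter fun e => e ∈ M ω).card ≤ 1 := by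
        rw [card_le_one]
        intro e he f hf
        simp only [mem_filter, SimpleGraph.mem_incidenceFinset] at he hf
        exact hmatch ω hω e he.2 f hf.2 v he.1.2 hf.1.2
      by_cases hex : ∃ e ∈ M ω, v ∈ e
      · rw [if_pos (show ω ∈ {ω | ∃ e ∈ M ω, v ∈ e} from hex)]
        have : (((G.incidenceFinset v).filter fun e => e ∈ M ω).card : ℝ) ≤ 1 := by
          exact_mod_cast hcard
        have := hwt0 ω
        nlinarith
      · rw [if_neg (show ω ∉ {ω | ∃ e ∈ M ω, v ∈ e} from hex)]
        have : ((G.incidenceFinset v).filter fun e => e ∈ M ω) = ∅ := by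
          rw [filter_eq_empty_iff]
          intro e he heM
          rw [SimpleGraph.mem_incidenceFinset] at he
          exact hex ⟨e, heM, he.2⟩
        simp [this]
  · intro e
    rw [hprob e]; exact hxy e
  · intro a t ht
    simp only [hintegral]
    have h1 := MBM.tail hwt0 hwt1 hVb hVb3 hy0 hy1 hmgf' a (⨆ i, |a i|)
      (Real.iSup_nonneg fun i => abs_nonneg _)
      (fun e => le_ciSup (f := fun i => |a i|) (Set.finite_range _).bddAbove e) t ht
    refine le_trans (le_of_eq ?_) h1
    rw [hμ]
    simp
end
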